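/- arXiv:2308.06586 — 3 statements merged into one kernel-verified Lean document; each statement's English description precedes it below -/
import Mathlib

section
/- For every n ≥ 1 and K > 0 there exists a constant C₀ > 0, depending only on n and K (and in particular independent of L), such that the following holds. Let L ≥ 1 and let 𝕋ⁿ_L = (ℝ/Lℤ)ⁿ. Let f : ℝ → ℝⁿ be differentiable and Lipschitz continuous on [-1,1] with Lipschitz constant at most K. Let ν > 0 and let u : [0,∞) × 𝕋ⁿ_L → ℝ be a smooth solution of ∂ₜu + div(f(u)) = ν Δu with initial data u₀ = u(0,·) satisfying ‖u₀‖_{L^∞} ≤ 1, ‖∇u₀‖_{L¹} ≤ 1, and ‖∇u₀‖_{L²} ≤ 1. Then for every t ≥ 0, ∫_{𝕋ⁿ_L} |∇u(t,x)|² dx ≤ C₀ (1 + ν⁻¹). -/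
open MeasureTheory

/-- The partial derivative in the `i`-th coordinate direction. -/
noncomputable def spaceDeriv {n : ℕ} (v : EuclideanSpace ℝ (Fin n) → ℝ) (i : Fin n)
    (x : EuclideanSpace ℝ (Fin n)) : ℝ :=
  fderiv ℝ v x (EuclideanSpace.single i 1)

/-- The Laplacian `Δv = Σᵢ ∂²v/∂xᵢ²`. -/
noncomputable def laplacian {n : ℕ} (v : EuclideanSpace ℝ (Fin n) → ℝ)
    (x : EuclideanSpace ℝ (Fin n)) : ℝ :=
  ∑ i, spaceDeriv (spaceDeriv v i) i x

/-- The divergence `div (f ∘ v) = Σᵢ ∂ᵢ(fᵢ(v))` of the flux `f` applied to `v`. -/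
noncomputable def divFlux {n : ℕ} (f : ℝ → EuclideanSpace ℝ (Fin n))
    (v : EuclideanSpace ℝ (Fin n) → ℝ) (x : EuclideanSpace ℝ (Fin n)) : ℝ :=
  ∑ i, spaceDeriv (fun y => f (v y) i) i x

/-- The fundamental domain `[0,L)ⁿ` of the torus `𝕋ⁿ_L = (ℝ/Lℤ)ⁿ`. -/
def fundamentalBox (n : ℕ) (L : ℝ) : Set (EuclideanSpace ℝ (Fin n)) :=
  {x | ∀ i, x i ∈ Set.Ico (0 : ℝ) L}

/-- The closed box. -/
def cbox (n : ℕ) (L : ℝ) : Set (EuclideanSpace ℝ (Fin n)) :=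
  {x | ∀ i, x i ∈ Set.Icc (0 : ℝ) L}

lemma cbox_eq_preimage (n : ℕ) (L : ℝ) :
    cbox n L = (@WithLp.ofLp 2 (Fin n → ℝ)) ⁻¹' (Set.Icc (fun _ => 0) (fun _ => L)) := by
  ext x
  simp only [cbox, Set.mem_ofPred_eq, Set.mem_preimage, Set.mem_Icc, Pi.le_def]
  exact ⟨fun h => ⟨fun i => (h i).1, fun i => (h i).2⟩, fun h i => ⟨h.1 i, h.2 i⟩⟩

lemma isCompact_cbox (n : ℕ) (L : ℝ) : IsCompact (cbox n L) := by
  rw [cbox_eq_preimage]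
  have := (EuclideanSpace.equiv (Fin n) ℝ).toHomeomorph.isCompact_preimage
    (s := Set.Icc (fun _ => (0:ℝ)) (fun _ => L))
  exact this.2 isCompact_Icc

lemma fundamentalBox_ae_eq (n : ℕ) (L : ℝ) :
    fundamentalBox n L =ᵐ[volume] cbox n L := by
  have h1 : fundamentalBox n L =
      (@WithLp.ofLp 2 (Fin n → ℝ)) ⁻¹' (Set.pi Set.univ fun _ => Set.Ico 0 L) := by
    ext x
    simp [fundamentalBox]
  rw [h1, cbox_eq_preimage]
  exact (PiLp.volume_preserving_ofLp (Fin n)).quasiMeasurePreserving.preimage_ae_eq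
    (Measure.univ_pi_Ico_ae_eq_Icc (μ := fun _ => volume))

lemma setIntegral_box (n : ℕ) (L : ℝ) (g : EuclideanSpace ℝ (Fin n) → ℝ) :
    ∫ x in fundamentalBox n L, g x = ∫ x in cbox n L, g x :=
  setIntegral_congr_set (fundamentalBox_ae_eq n L)

/-- Periodicity. -/
def Per {n : ℕ} (L : ℝ) (w : EuclideanSpace ℝ (Fin n) → ℝ) : Prop :=
  ∀ x (i : Fin n), w (x + L • EuclideanSpace.single i 1) = w x

lemma cont_int {n : ℕ} {L : ℝ} {w : EuclideanSpace ℝ (Fin n) → ℝ} (h : Continuous w) :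
    IntegrableOn w (cbox n L) :=
  h.continuousOn.integrableOn_compact (isCompact_cbox n L)

lemma int_deriv_zero {n : ℕ} (hn : 1 ≤ n) {L : ℝ} (hL : 0 ≤ L)
    {w : EuclideanSpace ℝ (Fin n) → ℝ} (hw : Differentiable ℝ w) (hp : Per L w) (j : Fin n)
    (hi : IntegrableOn (spaceDeriv w j) (cbox n L)) :
    ∫ x in cbox n L, spaceDeriv w j x = 0 := by
  obtain ⟨m, rfl⟩ : ∃ m, n = m + 1 := ⟨n - 1, by omega⟩
  let eL := (EuclideanSpace.equiv (Fin (m+1)) ℝ)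
  have hmp := (PiLp.volume_preserving_ofLp (Fin (m+1)))
  have hemb : MeasurableEmbedding (@WithLp.ofLp 2 (Fin (m+1) → ℝ)) :=
    eL.toHomeomorph.measurableEmbedding
  let W : (Fin (m+1) → ℝ) → ℝ := fun y => w (WithLp.toLp 2 y)
  let W' : (Fin (m+1) → ℝ) → (Fin (m+1) → ℝ) →L[ℝ] ℝ := fun y =>
    (fderiv ℝ w (WithLp.toLp 2 y)).comp (eL.symm : (Fin (m+1) → ℝ) →L[ℝ] _)
  have hW : ∀ y, HasFDerivAt W (W' y) y := fun y =>
    HasFDerivAt.comp (g := w) y (hw _).hasFDerivAt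
      (show HasFDerivAt (fun y : Fin (m+1) → ℝ => WithLp.toLp 2 y)
        (eL.symm : (Fin (m+1) → ℝ) →L[ℝ] EuclideanSpace ℝ (Fin (m+1))) y
        from eL.symm.hasFDerivAt)
  have hWc : Continuous W := continuous_iff_continuousAt.2 fun y => (hW y).continuousAt
  have hval : ∀ y, W' y (Pi.single j 1) = spaceDeriv w j (WithLp.toLp 2 y) := fun y => rfl
  have key := integral_divergence_of_hasFDerivAt_off_countable' (E := ℝ) (n := m)
    (fun _ => (0:ℝ)) (fun _ => L) (fun _ => hL)
    (fun i y => if i = j then W y else 0) (fun i y => if i = j then W' y else 0) ∅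
    Set.countable_empty
    (fun i => by by_cases h : i = j <;> simp [h, hWc.continuousOn, continuousOn_const])
    (fun y _ i => by
      by_cases h : i = j
      · simpa [h] using hW y
      · simpa [h] using hasFDerivAt_const (0:ℝ) y)
  have hsum : ∀ y : Fin (m+1) → ℝ, (∑ i, (if i = j then W' y else 0) (Pi.single i (1:ℝ)))
      = spaceDeriv w j (WithLp.toLp 2 y) := fun y => by
    rw [Finset.sum_eq_single j]
    · simp [hval]
    · intro b _ hb; simp [hb]
    · simp
  simp only [hsum] at key
  have hi' : IntegrableOn (fun y : Fin (m+1) → ℝ => spaceDeriv w j (WithLp.toLp 2 y))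
      (Set.Icc (fun _ => 0) (fun _ => L)) := by
    rw [← hmp.integrableOn_comp_preimage hemb, ← cbox_eq_preimage]
    exact hi
  have k2 := key hi'
  rw [cbox_eq_preimage]
  have k3 := hmp.setIntegral_preimage_emb hemb
    (fun y => spaceDeriv w j (WithLp.toLp 2 y)) (Set.Icc (fun _ => 0) (fun _ => L))
  simp only [WithLp.toLp_ofLp] at k3
  rw [k3, k2]
  refine Finset.sum_eq_zero fun i _ => ?_
  by_cases h : i = j
  · subst h
    simp only [if_true]
    rw [sub_eq_zero]
    congr 1
    ext y
    have : (WithLp.toLp 2 (i.insertNth L y) : EuclideanSpace ℝ (Fin (m+1))) =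
      WithLp.toLp 2 (i.insertNth (0:ℝ) y) + L • EuclideanSpace.single i 1 := by
      ext k
      refine Fin.succAboveCases i ?_ (fun k => ?_) k
      · simp
      · simp [Fin.succAbove_ne]
    simp only [W]
    rw [this, hp]
  · simp [h]

lemma spaceDeriv_mul {n : ℕ} {a b : EuclideanSpace ℝ (Fin n) → ℝ} {x : EuclideanSpace ℝ (Fin n)}
    (ha : DifferentiableAt ℝ a x) (hb : DifferentiableAt ℝ b x) (j : Fin n) :
    spaceDeriv (fun y => a y * b y) j x = a x * spaceDeriv b j x + spaceDeriv a j x * b x := by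
  unfold spaceDeriv
  rw [fderiv_fun_mul ha hb]
  simp
  ring

lemma ibp {n : ℕ} (hn : 1 ≤ n) {L : ℝ} (hL : 0 ≤ L)
    {a b : EuclideanSpace ℝ (Fin n) → ℝ} (ha : Differentiable ℝ a) (hb : Differentiable ℝ b)
    (pa : Per L a) (pb : Per L b) (j : Fin n)
    (ia : IntegrableOn (spaceDeriv a j) (cbox n L)) (ib : IntegrableOn (spaceDeriv b j) (cbox n L)) :
    ∫ x in cbox n L, a x * spaceDeriv b j x = - ∫ x in cbox n L, spaceDeriv a j x * b x := by
  have i1 : IntegrableOn (fun x => a x * spaceDeriv b j x) (cbox n L) :=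
    ib.continuousOn_mul ha.continuous.continuousOn (isCompact_cbox n L)
  have i2 : IntegrableOn (fun x => spaceDeriv a j x * b x) (cbox n L) :=
    ia.mul_continuousOn hb.continuous.continuousOn (isCompact_cbox n L)
  have e : spaceDeriv (fun y => a y * b y) j =
      fun x => a x * spaceDeriv b j x + spaceDeriv a j x * b x := by
    ext x; exact spaceDeriv_mul (ha x) (hb x) j
  have := int_deriv_zero hn hL (ha.mul hb) (fun x i => by simp [pa x i, pb x i]) j
    (show IntegrableOn (spaceDeriv (fun y => a y * b y) j) _ by rw [e]; exact i1.add i2)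
  change ∫ x in cbox n L, spaceDeriv (fun y => a y * b y) j x = 0 at this
  rw [e, integral_add i1 i2] at this
  linarith

lemma per_spaceDeriv {n : ℕ} {L : ℝ} {a : EuclideanSpace ℝ (Fin n) → ℝ} (pa : Per L a) (j : Fin n) :
    Per L (spaceDeriv a j) := by
  intro x i
  unfold spaceDeriv
  rw [← fderiv_comp_add_right]
  congr 2
  ext y
  exact pa y i

lemma cd_spaceDeriv {n : ℕ} {a : EuclideanSpace ℝ (Fin n) → ℝ}
    (ha : ContDiff ℝ (⊤ : ℕ∞) a) (j : Fin n) : ContDiff ℝ (⊤ : ℕ∞) (spaceDeriv a j) := by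
  unfold spaceDeriv
  exact (ha.fderiv_right (m := (⊤ : ℕ∞)) (by simp)).clm_apply contDiff_const

lemma spaceDeriv_comm {n : ℕ} {a : EuclideanSpace ℝ (Fin n) → ℝ}
    (ha : ContDiff ℝ (⊤ : ℕ∞) a) (i j : Fin n) (x : EuclideanSpace ℝ (Fin n)) :
    spaceDeriv (spaceDeriv a i) j x = spaceDeriv (spaceDeriv a j) i x := by
  have hs : IsSymmSndFDerivAt ℝ a x := ha.contDiffAt.isSymmSndFDerivAt (by simp; exact ENat.LEInfty.out)
  have hd : DifferentiableAt ℝ (fderiv ℝ a) x :=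
    ((ha.fderiv_right (m := (⊤ : ℕ∞)) (by simp)).differentiable (by simp)) x
  have h : ∀ i j : Fin n, spaceDeriv (spaceDeriv a i) j x =
      fderiv ℝ (fderiv ℝ a) x (EuclideanSpace.single j 1) (EuclideanSpace.single i 1) := by
    intro i j
    unfold spaceDeriv
    rw [fderiv_clm_apply hd (differentiableAt_const _)]
    simp
  rw [h, h]
  exact hs _ _

lemma swap {n : ℕ} (hn : 1 ≤ n) {L : ℝ} (hL : 0 ≤ L)
    {a b : EuclideanSpace ℝ (Fin n) → ℝ} (ha : ContDiff ℝ (⊤ : ℕ∞) a) (hb : Differentiable ℝ b)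
    (pa : Per L a) (pb : Per L b) (i j : Fin n)
    (ib : ∀ k, IntegrableOn (spaceDeriv b k) (cbox n L)) :
    ∫ x in cbox n L, spaceDeriv a i x * spaceDeriv b j x =
      ∫ x in cbox n L, spaceDeriv a j x * spaceDeriv b i x := by
  have hd := fun k => (cd_spaceDeriv ha k).differentiable (by simp)
  have hc := fun k l => (cont_int (L := L) (cd_spaceDeriv (cd_spaceDeriv ha k) l).continuous)
  rw [ibp hn hL (hd i) hb (per_spaceDeriv pa i) pb j (hc i j) (ib j),
    ibp hn hL (hd j) hb (per_spaceDeriv pa j) pb i (hc j i) (ib i)]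
  simp only [spaceDeriv_comm ha i j]

lemma deriv_bound {n : ℕ} {K : ℝ} (hK : 0 < K) {f : ℝ → EuclideanSpace ℝ (Fin n)}
    (hf : Differentiable ℝ f) (hl : LipschitzOnWith K.toNNReal f (Set.Icc (-1) 1))
    {y : ℝ} (hy : |y| ≤ 1) : ‖deriv f y‖ ≤ K := by
  have hm : y ∈ Set.Icc (-1:ℝ) 1 := abs_le.1 hy
  have hu : UniqueDiffWithinAt ℝ (Set.Icc (-1:ℝ) 1) y := uniqueDiffOn_Icc (by norm_num) y hm
  have h1 : HasDerivWithinAt f (deriv f y) (Set.Icc (-1:ℝ) 1) y := (hf y).hasDerivAt.hasDerivWithinAt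
  rw [hasDerivWithinAt_iff_tendsto_slope] at h1
  have hacc : AccPt y (Filter.principal (Set.Icc (-1:ℝ) 1)) := uniqueDiffWithinAt_iff_accPt.1 hu
  have : (nhdsWithin y (Set.Icc (-1:ℝ) 1 \ {y})).NeBot := by
    rw [accPt_principal_iff_nhdsWithin] at hacc
    exact hacc
  refine le_of_tendsto h1.norm ?_
  filter_upwards [self_mem_nhdsWithin] with z hz
  have h2 := hl.dist_le_mul z hz.1 y hm
  rw [Real.coe_toNNReal K hK.le, dist_eq_norm, dist_eq_norm] at h2
  have hzy : 0 < ‖z - y‖ := norm_pos_iff.2 (sub_ne_zero.2 hz.2)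
  rw [slope_def_module, norm_smul, norm_inv, inv_mul_le_iff₀ hzy]
  linarith

lemma spaceDeriv_comp {n : ℕ} {g : ℝ → ℝ} {a : EuclideanSpace ℝ (Fin n) → ℝ}
    {x : EuclideanSpace ℝ (Fin n)} (hg : DifferentiableAt ℝ g (a x))
    (ha : DifferentiableAt ℝ a x) (j : Fin n) :
    spaceDeriv (fun y => g (a y)) j x = deriv g (a x) * spaceDeriv a j x := by
  unfold spaceDeriv
  have := (hg.hasDerivAt.comp_hasFDerivAt x ha.hasFDerivAt).fderiv
  change fderiv ℝ (fun y => g (a y)) x = _ at this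
  rw [this]
  simp

lemma flux_comp_diff {n : ℕ} {f : ℝ → EuclideanSpace ℝ (Fin n)} (hf : Differentiable ℝ f)
    (j : Fin n) (y : ℝ) : HasDerivAt (fun s => f s j) (deriv f y j) y := by
  have h := (hf y).hasDerivAt
  exact ((EuclideanSpace.proj j : EuclideanSpace ℝ (Fin n) →L[ℝ] ℝ).hasFDerivAt).comp_hasDerivAt y h

lemma pointwise_ineq {n : ℕ} {K ν : ℝ} (hν : 0 < ν) (q : EuclideanSpace ℝ (Fin n))
    (hq : ‖q‖ ≤ K) (w : Fin n → ℝ) (v : ℝ) :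
    -(∑ j, w j * (ν * w j - q j * v)) ≤ K ^ 2 * v ^ 2 / (2 * ν) - ν / 2 * ∑ j, w j ^ 2 := by
  have hq2 : ∑ j, (q j) ^ 2 ≤ K ^ 2 := by
    have := EuclideanSpace.norm_sq_eq q
    simp only [Real.norm_eq_abs, sq_abs] at this
    rw [← this]
    exact pow_le_pow_left₀ (norm_nonneg _) hq 2
  have h : ∀ j, -(w j * (ν * w j - q j * v)) ≤ (q j)^2 * (v^2 / (2*ν)) - ν/2 * w j ^ 2 := by
    intro j
    have : (q j)^2 * (v^2 / (2*ν)) - ν/2 * w j ^ 2 + w j * (ν * w j - q j * v)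
      = (q j * v - ν * w j)^2 / (2 * ν) := by field_simp; ring
    have h2 : 0 ≤ (q j * v - ν * w j)^2 / (2 * ν) := by positivity
    linarith
  rw [← Finset.sum_neg_distrib]
  refine (Finset.sum_le_sum fun j _ => h j).trans ?_
  rw [Finset.sum_sub_distrib, ← Finset.sum_mul, ← Finset.mul_sum]
  have : (∑ j, (q j)^2) * (v^2/(2*ν)) ≤ K^2 * (v^2/(2*ν)) :=
    mul_le_mul_of_nonneg_right hq2 (by positivity)
  have e : K^2 * (v^2/(2*ν)) = K ^ 2 * v ^ 2 / (2 * ν) := by ring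
  linarith

lemma slice {n : ℕ} (hn : 1 ≤ n) {K : ℝ} (hK : 0 < K) {L : ℝ} (hL : 0 ≤ L)
    {f : ℝ → EuclideanSpace ℝ (Fin n)}
    (hf : Differentiable ℝ f) (hl : LipschitzOnWith K.toNNReal f (Set.Icc (-1) 1))
    {ν : ℝ} (hν : 0 < ν) {a b : EuclideanSpace ℝ (Fin n) → ℝ}
    (ha : ContDiff ℝ (⊤ : ℕ∞) a) (hb : ContDiff ℝ (⊤ : ℕ∞) b) (pa : Per L a) (pb : Per L b)
    (ha1 : ∀ x, |a x| ≤ 1) (hpde : ∀ x, b x + divFlux f a x = ν * laplacian a x)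
    {η : ℝ → ℝ} (hη : ContDiff ℝ (⊤ : ℕ∞) η) (hη2 : ∀ s, 0 ≤ deriv (deriv η) s) (i : Fin n) :
    ∫ x in cbox n L, deriv η (spaceDeriv a i x) * spaceDeriv b i x ≤
      ∫ x in cbox n L, deriv (deriv η) (spaceDeriv a i x) *
        (K ^ 2 * (spaceDeriv a i x) ^ 2 / (2 * ν) -
          ν / 2 * ∑ j, (spaceDeriv (spaceDeriv a i) j x) ^ 2) := by
  have hη1c : ContDiff ℝ (⊤ : ℕ∞) (deriv η) := by
    have := ContDiff.iterate_deriv 1 hη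
    simpa using this
  have hη2c : ContDiff ℝ (⊤ : ℕ∞) (deriv (deriv η)) := by
    have := ContDiff.iterate_deriv 1 hη1c
    simpa using this
  have hv := cd_spaceDeriv ha i
  have hvv := fun j => cd_spaceDeriv hv j
  set φ : EuclideanSpace ℝ (Fin n) → ℝ := fun x => deriv η (spaceDeriv a i x) with hφdef
  have hφ : ContDiff ℝ (⊤ : ℕ∞) φ := hη1c.comp hv
  have pφ : Per L φ := fun x k => by
    simp only [hφdef]; rw [per_spaceDeriv pa i x k]
  have dφ : ∀ j x, spaceDeriv φ j x =
      deriv (deriv η) (spaceDeriv a i x) * spaceDeriv (spaceDeriv a i) j x := fun j x =>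
    spaceDeriv_comp (hη1c.differentiable (by simp) _) (hv.differentiable (by simp) _) j
  have had : Differentiable ℝ a := ha.differentiable (by simp)
  -- the fields
  let H : Fin n → EuclideanSpace ℝ (Fin n) → ℝ := fun j y => ν * spaceDeriv a j y - f (a y) j
  have hFd : ∀ j, Differentiable ℝ (fun y => f (a y) j) := fun j y =>
    (flux_comp_diff hf j (a y)).differentiableAt.comp y (had y)
  have hsd : ∀ j, Differentiable ℝ (fun y => ν * spaceDeriv a j y) := fun j =>
    ((cd_spaceDeriv ha j).differentiable (by simp)).const_mul ν
  have hHd : ∀ j, Differentiable ℝ (H j) := fun j => (hsd j).sub (hFd j)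
  have pH : ∀ j, Per L (H j) := fun j x k => by
    simp only [H]; rw [per_spaceDeriv pa j x k, pa x k]
  have dF : ∀ j k x, spaceDeriv (fun y => f (a y) j) k x = deriv f (a x) j * spaceDeriv a k x := by
    intro j k x
    have h := spaceDeriv_comp (g := fun s => f s j) (flux_comp_diff hf j (a x)).differentiableAt
      (had x) k
    rw [(flux_comp_diff hf j (a x)).deriv] at h
    exact h
  have dH0 : ∀ j k x, spaceDeriv (H j) k x = ν * spaceDeriv (spaceDeriv a j) k x
      - spaceDeriv (fun y => f (a y) j) k x := by
    intro j k x
    have h1 : fderiv ℝ (H j) x = _ := fderiv_fun_sub (hsd j x) (hFd j x)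
    have h2 := fderiv_const_mul ((cd_spaceDeriv ha j).differentiable (by simp) x) ν
    unfold spaceDeriv at *
    rw [h1, h2]
    simp
  have iF : ∀ j k, IntegrableOn (spaceDeriv (fun y => f (a y) j) k) (cbox n L) := by
    intro j k
    have hm : AEStronglyMeasurable (fun x => deriv f (a x) j) volume := by
      have h1 : Measurable (deriv (fun s => f s j)) := measurable_deriv _
      have h2 : (fun x => deriv f (a x) j) = fun x => deriv (fun s => f s j) (a x) := by
        ext x; exact (flux_comp_diff hf j (a x)).deriv.symm
      rw [h2]
      exact (h1.comp ha.continuous.measurable).aestronglyMeasurable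
    have hbd : IntegrableOn (fun x => deriv f (a x) j) (cbox n L) := by
      refine Measure.integrableOn_of_bounded (M := K) (isCompact_cbox n L).measure_lt_top.ne hm ?_
      refine Filter.Eventually.of_forall fun x => ?_
      exact (PiLp.norm_apply_le _ j).trans (deriv_bound hK hf hl (ha1 x))
    have := hbd.mul_continuousOn (cd_spaceDeriv ha k).continuous.continuousOn (isCompact_cbox n L)
    refine this.congr_fun_ae (Filter.Eventually.of_forall fun x => ?_)
    exact (dF j k x).symm
  have iH : ∀ j k, IntegrableOn (spaceDeriv (H j) k) (cbox n L) := by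
    intro j k
    have e : spaceDeriv (H j) k = fun x => ν * spaceDeriv (spaceDeriv a j) k x
      - spaceDeriv (fun y => f (a y) j) k x := funext fun x => dH0 j k x
    rw [e]
    exact (cont_int ((cd_spaceDeriv (cd_spaceDeriv ha j) k).continuous.const_smul ν)).sub (iF j k)
  have hbH : ∀ x, b x = ∑ j, spaceDeriv (H j) j x := by
    intro x
    simp only [dH0, Finset.sum_sub_distrib, ← Finset.mul_sum]
    have := hpde x
    unfold divFlux laplacian at this
    linarith
  have iprod : ∀ j k l, IntegrableOn (fun x => spaceDeriv φ l x * spaceDeriv (H j) k x) (cbox n L) :=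
    fun j k l => (iH j k).continuousOn_mul (cd_spaceDeriv hφ l).continuous.continuousOn
      (isCompact_cbox n L)
  have e1 : ∫ x in cbox n L, φ x * spaceDeriv b i x =
      ∫ x in cbox n L, -(∑ j, spaceDeriv φ j x * spaceDeriv (H j) i x) := by
    rw [ibp hn hL (hφ.differentiable (by simp)) (hb.differentiable (by simp)) pφ pb i
      (cont_int (cd_spaceDeriv hφ i).continuous) (cont_int (cd_spaceDeriv hb i).continuous)]
    rw [integral_neg, integral_finsetSum _ (fun j _ => iprod j i j)]
    simp only [hbH, Finset.mul_sum]
    rw [integral_finsetSum _ (fun j _ => iprod j j i)]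
    congr 1
    exact Finset.sum_congr rfl fun j _ => swap hn hL hφ (hHd j) pφ (pH j) i j (iH j)
  rw [e1]
  refine integral_mono (integrable_finsetSum _ (fun j _ => iprod j i j)).neg ?_ fun x => ?_
  · refine cont_int ?_
    have c1 := hη2c.continuous.comp hv.continuous
    have c2 := hv.continuous
    have c3 := fun j => (hvv j).continuous
    refine c1.mul ?_
    fun_prop
  · have := pointwise_ineq hν (deriv f (a x)) (deriv_bound hK hf hl (ha1 x))
      (fun j => spaceDeriv (spaceDeriv a i) j x) (spaceDeriv a i x)
    refine le_trans (le_of_eq ?_) (mul_le_mul_of_nonneg_left this (hη2 (spaceDeriv a i x)))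
    rw [mul_neg, Finset.mul_sum]
    congr 1
    refine Finset.sum_congr rfl fun j _ => ?_
    rw [dφ, dH0, dF, spaceDeriv_comm ha j i]
    ring

lemma interp {n : ℕ} (hn : 1 ≤ n) {L : ℝ} (hL : 0 ≤ L) {a : EuclideanSpace ℝ (Fin n) → ℝ}
    (ha : ContDiff ℝ (⊤ : ℕ∞) a) (pa : Per L a) (ha1 : ∀ x, |a x| ≤ 1) (i : Fin n)
    (hB : ∫ x in cbox n L, |spaceDeriv a i x| ≤ 1) :
    (∫ x in cbox n L, (spaceDeriv a i x) ^ 2) ^ 3 ≤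
      72 * ∫ x in cbox n L, ∑ j, (spaceDeriv (spaceDeriv a i) j x) ^ 2 := by
  have hv := cd_spaceDeriv ha i
  have pv := per_spaceDeriv pa i
  have hvv := fun j => cd_spaceDeriv hv j
  set v := spaceDeriv a i with hvdef
  have cv := hv.continuous
  have cvv := fun j => (hvv j).continuous
  have ca := ha.continuous
  set D := ∫ x in cbox n L, ∑ j, (spaceDeriv v j x) ^ 2 with hD
  set Q := ∫ x in cbox n L, (v x) ^ 4 with hQ
  set E := ∫ x in cbox n L, (v x) ^ 2 with hE
  have hQ0 : 0 ≤ Q := integral_nonneg fun x => by positivity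
  have hE0 : 0 ≤ E := integral_nonneg fun x => by positivity
  -- Q ≤ 9 D
  have hQD : Q ≤ 9 * D := by
    have h3 : Differentiable ℝ (fun x => v x ^ 3) := (hv.pow 3).differentiable (by simp)
    have d3 : ∀ x, spaceDeriv (fun x => v x ^ 3) i x = 3 * v x ^ 2 * spaceDeriv v i x := by
      intro x
      rw [spaceDeriv_comp (g := fun s => s ^ 3) (by fun_prop) (hv.differentiable (by simp) x) i]
      simp
    have h := ibp hn hL (ha.differentiable (by simp)) h3 pa
      (fun x k => by simp only [pv x k]) i (cont_int cv)
      (cont_int (cd_spaceDeriv (hv.pow 3) i).continuous)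
    have e1 : ∫ x in cbox n L, spaceDeriv a i x * v x ^ 3 = Q := by
      congr 1; ext x; rw [← hvdef]; ring
    rw [e1] at h
    simp only [d3] at h
    have h2 : Q = ∫ x in cbox n L, -(a x * (3 * v x ^ 2 * spaceDeriv v i x)) := by
      rw [integral_neg, h]; ring
    have h4 : Q ≤ ∫ x in cbox n L, (1/2 * v x ^ 4 + 9/2 * ∑ j, (spaceDeriv v j x) ^ 2) := by
      rw [h2]
      refine integral_mono (cont_int (by fun_prop)) (cont_int (by fun_prop)) fun x => ?_
      have s1 : (spaceDeriv v i x) ^ 2 ≤ ∑ j, (spaceDeriv v j x) ^ 2 :=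
        Finset.single_le_sum (f := fun j => (spaceDeriv v j x) ^ 2)
          (fun j _ => sq_nonneg _) (Finset.mem_univ i)
      have s2 : (a x) ^ 2 ≤ 1 := by
        rw [← sq_abs]; exact pow_le_one₀ (abs_nonneg _) (ha1 x)
      have s3 : -(a x * (3 * v x ^ 2 * spaceDeriv v i x)) ≤
          1/2 * v x ^ 4 + 9/2 * (a x ^ 2 * (spaceDeriv v i x) ^ 2) := by
        nlinarith [sq_nonneg (v x ^ 2 + 3 * a x * spaceDeriv v i x)]
      have s4 : a x ^ 2 * (spaceDeriv v i x) ^ 2 ≤ 1 * (spaceDeriv v i x) ^ 2 :=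
        mul_le_mul_of_nonneg_right s2 (sq_nonneg _)
      change -(a x * (3 * v x ^ 2 * spaceDeriv v i x)) ≤ 
        1/2 * v x ^ 4 + 9/2 * ∑ j, (spaceDeriv v j x) ^ 2
      linarith
    rw [integral_add (cont_int (by fun_prop)) (cont_int (by fun_prop)),
      integral_const_mul, integral_const_mul] at h4
    linarith
  -- E^3 ≤ 8 Q
  rcases hE0.eq_or_lt with h0 | hpos
  · rw [← h0]
    have : 0 ≤ D := by linarith
    simpa using by positivity
  · have hs : 0 < E / 2 := by positivity
    have h5 : E ≤ ∫ x in cbox n L, (E/2 * |v x| + 1/(E/2)^2 * v x ^ 4) := by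
      conv_lhs => rw [hE]
      refine integral_mono (cont_int (by fun_prop)) (cont_int (by fun_prop)) fun x => ?_
      change v x ^ 2 ≤ E/2 * |v x| + 1/(E/2)^2 * v x ^ 4
      generalize E / 2 = s at hs
      rw [← sq_abs, show v x ^ 4 = |v x| ^ 4 by rw [show (4:ℕ) = 2*2 by rfl, pow_mul, pow_mul, sq_abs]]
      generalize hz : |v x| = z
      have hz0 : 0 ≤ z := hz ▸ abs_nonneg _
      rcases le_total z s with h | h
      · have : 0 ≤ 1 / s^2 * z^4 := by positivity
        nlinarith
      · have : z^2 ≤ 1/s^2 * z^4 := by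
          rw [one_div_mul_eq_div, le_div_iff₀ (by positivity)]
          have : s^2 ≤ z^2 := pow_le_pow_left₀ hs.le h 2
          nlinarith [sq_nonneg z]
        have : 0 ≤ s * z := by positivity
        linarith
    rw [integral_add (cont_int (by fun_prop)) (cont_int (by fun_prop)),
      integral_const_mul, integral_const_mul] at h5
    have h6 : E/2 * ∫ x in cbox n L, |v x| ≤ E/2 * 1 := mul_le_mul_of_nonneg_left hB hs.le
    have h7 : E / 2 ≤ 1/(E/2)^2 * Q := by linarith
    rw [one_div_mul_eq_div, le_div_iff₀ (by positivity)] at h7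
    nlinarith

lemma per_reduce {n : ℕ} {L : ℝ} (hL : 0 < L) (x : EuclideanSpace ℝ (Fin n)) :
    ∃ y ∈ cbox n L, ∀ w : EuclideanSpace ℝ (Fin n) → ℝ, Per L w → w x = w y := by
  let k : Fin n → ℤ := fun i => ⌊x i / L⌋
  have key : ∀ w : EuclideanSpace ℝ (Fin n) → ℝ, Per L w → ∀ s : Finset (Fin n),
      w (x + ∑ i ∈ s, (((-k i : ℤ) : ℝ) * L) • EuclideanSpace.single i 1) = w x := by
    intro w hw s
    induction s using Finset.induction_on with
    | empty => simp
    | insert i s hi ih =>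
      rw [Finset.sum_insert hi, add_comm (_ • _), ← add_assoc]
      set z := x + ∑ i ∈ s, (((-k i : ℤ) : ℝ) * L) • EuclideanSpace.single i 1
      have hper : Function.Periodic (fun r : ℝ => w (z + r • EuclideanSpace.single i 1)) L := by
        intro r
        simp only [add_smul, ← add_assoc]
        exact hw _ i
      have h := hper.int_mul (-k i) 0
      simp only [zero_add, zero_smul, add_zero] at h
      rw [h, ih]
  refine ⟨x + ∑ i, (((-k i : ℤ) : ℝ) * L) • EuclideanSpace.single i 1, ?_,
    fun w hw => (key w hw Finset.univ).symm⟩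
  intro i
  have : (x + ∑ i, (((-k i : ℤ) : ℝ) * L) • EuclideanSpace.single i (1:ℝ) :
      EuclideanSpace ℝ (Fin n)) i = x i - k i * L := by
    simp [Finset.sum_apply, Pi.single_apply]
    ring
  rw [this]
  have h1 := Int.floor_le (x i / L)
  have h2 := Int.lt_floor_add_one (x i / L)
  rw [le_div_iff₀ hL] at h1
  rw [div_lt_iff₀ hL] at h2
  constructor <;> simp only [k] <;> linarith

lemma max_principle {n : ℕ} {L : ℝ} (hL : 0 < L) (w : ℝ → EuclideanSpace ℝ (Fin n) → ℝ)
    (hc : ContinuousOn (Function.uncurry w) (Set.Ici 0 ×ˢ Set.univ)) (hp : ∀ t, Per L (w t))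
    (h0 : ∀ x, w 0 x ≤ 1)
    (hd : ∀ t x, 0 < t → (∀ y, w t y ≤ w t x) → ∃ d ≤ 0, HasDerivAt (fun s => w s x) d t)
    (T : ℝ) (hT : 0 ≤ T) (x : EuclideanSpace ℝ (Fin n)) : w T x ≤ 1 := by
  have main : ∀ ε > 0, w T x ≤ 1 + ε * T := by
    intro ε hε
    have hcomp : IsCompact (Set.Icc 0 T ×ˢ cbox n L) := isCompact_Icc.prod (isCompact_cbox n L)
    obtain ⟨y, hy, hxy⟩ := per_reduce hL x
    have hcont : ContinuousOn (fun p : ℝ × EuclideanSpace ℝ (Fin n) =>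
        Function.uncurry w p - ε * p.1) (Set.Icc 0 T ×ˢ cbox n L) :=
      (hc.mono (Set.prod_mono (fun s hs => hs.1) (Set.subset_univ _))).sub
        (by fun_prop)
    obtain ⟨⟨t0, x0⟩, hm, hmax⟩ := hcomp.exists_isMaxOn ⟨(T, y), ⟨⟨hT, le_rfl⟩, hy⟩⟩ hcont
    have hmax' : ∀ s ∈ Set.Icc 0 T, ∀ z ∈ cbox n L, w s z - ε * s ≤ w t0 x0 - ε * t0 :=
      fun s hs z hz => hmax (a := (s, z)) ⟨hs, hz⟩
    have hTy := hmax' T ⟨hT, le_rfl⟩ y hy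
    rw [hxy _ (hp T)]
    rcases hm.1.1.eq_or_lt with h | h
    · simp only at h
      rw [← h] at hTy
      have := h0 x0
      linarith
    · exfalso
      simp only at h
      have hglob : ∀ z, w t0 z ≤ w t0 x0 := by
        intro z
        obtain ⟨z', hz', e⟩ := per_reduce hL z
        rw [e _ (hp t0)]
        have := hmax' t0 hm.1 z' hz'
        linarith
      obtain ⟨d, hd0, hder⟩ := hd t0 x0 h hglob
      have hder2 : HasDerivAt (fun s => w s x0 - ε * s) (d - ε * 1) t0 :=
        hder.sub ((hasDerivAt_id t0).const_mul ε)
      have ht := (hasDerivWithinAt_iff_tendsto_slope' (by simp)).1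
        (hder2.hasDerivWithinAt (s := Set.Iio t0))
      have : 0 ≤ d - ε * 1 := by
        refine ge_of_tendsto ht ?_
        filter_upwards [self_mem_nhdsWithin,
          mem_nhdsWithin_of_mem_nhds (Ioi_mem_nhds h)] with s hs hs0
        rw [slope_def_field]
        have hs' : s < t0 := hs
        have hs0' : 0 < s := hs0
        refine div_nonneg_of_nonpos ?_ (by linarith)
        have := hmax' s ⟨hs0'.le, hs'.le.trans hm.1.2⟩ x0 hm.2
        linarith
      linarith
  by_contra hcon
  push Not at hcon
  have := main ((w T x - 1) / (2 * (T + 1))) (by apply div_pos <;> linarith)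
  have h2 : (w T x - 1) / (2 * (T + 1)) * T ≤ (w T x - 1) / 2 := by
    rw [div_mul_eq_mul_div, div_le_div_iff₀ (by linarith) (by norm_num)]
    nlinarith
  linarith

lemma second_deriv_max {n : ℕ} {a : EuclideanSpace ℝ (Fin n) → ℝ}
    (ha : ContDiff ℝ (⊤ : ℕ∞) a) {x : EuclideanSpace ℝ (Fin n)} (hx : ∀ y, a y ≤ a x) (j : Fin n) :
    spaceDeriv (spaceDeriv a j) j x ≤ 0 := by
  let l : ℝ → EuclideanSpace ℝ (Fin n) := fun s => x + s • EuclideanSpace.single j 1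
  have hl : ∀ s, HasDerivAt l (EuclideanSpace.single j 1) s := fun s => by
    have h : HasDerivAt l ((1:ℝ) • EuclideanSpace.single j (1:ℝ)) s :=
      ((hasDerivAt_id s).smul_const (EuclideanSpace.single j (1:ℝ))).const_add x
    rwa [one_smul] at h
  have comp : ∀ b : EuclideanSpace ℝ (Fin n) → ℝ, ContDiff ℝ (⊤ : ℕ∞) b →
      deriv (fun s => b (l s)) = fun s => spaceDeriv b j (l s) := by
    intro b hb
    ext s
    exact ((hb.differentiable (by simp) (l s)).hasFDerivAt.comp_hasDerivAt s (hl s)).deriv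
  have e1 := comp a ha
  have e2 : deriv (deriv (fun s => a (l s))) 0 = spaceDeriv (spaceDeriv a j) j x := by
    rw [e1, comp _ (cd_spaceDeriv ha j)]
    simp [l]
  have hmax : IsLocalMax (fun s => a (l s)) 0 := by
    refine Filter.Eventually.of_forall fun s => ?_
    simpa [l] using hx (l s)
  by_contra hcon
  push Not at hcon
  rw [← e2] at hcon
  have hlc : Continuous l := continuous_iff_continuousAt.2 fun s => (hl s).continuousAt
  have hmin := isLocalMin_of_deriv_deriv_pos hcon hmax.deriv_eq_zero
    (ha.continuous.comp hlc).continuousAt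
  have heq : (fun s => a (l s)) =ᶠ[nhds 0] fun _ => a (l 0) := by
    filter_upwards [hmax, hmin] with s h1 h2
    exact le_antisymm h1 h2
  have := heq.deriv.deriv.eq_of_nhds
  rw [this] at hcon
  simp at hcon

lemma barrier {E E' : ℝ → ℝ} {M : ℝ} (hc : ContinuousOn E (Set.Ici 0))
    (hd : ∀ t, 0 < t → HasDerivAt E (E' t) t) (h0 : E 0 ≤ M)
    (hneg : ∀ t, 0 < t → M < E t → E' t ≤ 0) (T : ℝ) (hT : 0 ≤ T) : E T ≤ M := by
  by_contra hcon
  push Not at hcon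
  let S := Set.Icc 0 T ∩ E ⁻¹' Set.Iic M
  have hS : IsCompact S := by
    refine isCompact_Icc.of_isClosed_subset ?_ Set.inter_subset_left
    exact (hc.mono fun s hs => hs.1).preimage_isClosed_of_isClosed isClosed_Icc isClosed_Iic
  have hne : S.Nonempty := ⟨0, ⟨le_rfl, hT⟩, h0⟩
  obtain ⟨s, hs, hsup⟩ := hS.exists_isGreatest hne
  have hsT : s ≤ T := hs.1.2
  have hanti : AntitoneOn E (Set.Icc s T) := by
    refine antitoneOn_of_deriv_nonpos (convex_Icc s T) (hc.mono fun r hr => hs.1.1.trans hr.1) ?_ ?_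
    · intro r hr
      rw [interior_Icc] at hr
      exact (hd r (hs.1.1.trans_lt hr.1)).differentiableAt.differentiableWithinAt
    · intro r hr
      rw [interior_Icc] at hr
      have hr0 := hs.1.1.trans_lt hr.1
      rw [(hd r hr0).deriv]
      refine hneg r hr0 ?_
      by_contra hle
      push Not at hle
      exact absurd (hsup ⟨⟨hr0.le, hr.2.le⟩, hle⟩) (not_le.2 hr.1)
  have h1 := hanti ⟨le_rfl, hsT⟩ ⟨hsT, le_rfl⟩ hsT
  have h2 : E s ≤ M := hs.2
  linarith

/-- The open half space of positive times. -/
def Om (n : ℕ) : Set (ℝ × EuclideanSpace ℝ (Fin n)) := {p | 0 < p.1}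

lemma isOpen_Om (n : ℕ) : IsOpen (Om n) := isOpen_lt continuous_const continuous_fst

lemma cdat {n : ℕ} {G : ℝ × EuclideanSpace ℝ (Fin n) → ℝ} (hG : ContDiffOn ℝ (⊤ : ℕ∞) G (Om n))
    {t : ℝ} (ht : 0 < t) (x : EuclideanSpace ℝ (Fin n)) : ContDiffAt ℝ (⊤ : ℕ∞) G (t, x) :=
  hG.contDiffAt ((isOpen_Om n).mem_nhds ht)

lemma cd_D {n : ℕ} {G : ℝ × EuclideanSpace ℝ (Fin n) → ℝ} (hG : ContDiffOn ℝ (⊤ : ℕ∞) G (Om n))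
    (e : ℝ × EuclideanSpace ℝ (Fin n)) :
    ContDiffOn ℝ (⊤ : ℕ∞) (fun p => fderiv ℝ G p e) (Om n) :=
  (hG.fderiv_of_isOpen (isOpen_Om n) (m := (⊤ : ℕ∞)) (by simp)).clm_apply contDiffOn_const

lemma slice_cd {n : ℕ} {G : ℝ × EuclideanSpace ℝ (Fin n) → ℝ} (hG : ContDiffOn ℝ (⊤ : ℕ∞) G (Om n))
    {t : ℝ} (ht : 0 < t) : ContDiff ℝ (⊤ : ℕ∞) (fun x => G (t, x)) := by
  rw [contDiff_iff_contDiffAt]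
  intro x
  exact (cdat hG ht x).comp x (contDiffAt_const.prodMk contDiffAt_id)

lemma slice_D {n : ℕ} {G : ℝ × EuclideanSpace ℝ (Fin n) → ℝ} (hG : ContDiffOn ℝ (⊤ : ℕ∞) G (Om n))
    {t : ℝ} (ht : 0 < t) (i : Fin n) (x : EuclideanSpace ℝ (Fin n)) :
    spaceDeriv (fun x => G (t, x)) i x = fderiv ℝ G (t, x) (0, EuclideanSpace.single i 1) := by
  have h1 := ((cdat hG ht x).differentiableAt (by simp)).hasFDerivAt
  have h2 := h1.comp x (hasFDerivAt_prodMk_right t x)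
  unfold spaceDeriv
  rw [show fderiv ℝ (fun x => G (t, x)) x = _ from h2.fderiv]
  simp

lemma time_D {n : ℕ} {G : ℝ × EuclideanSpace ℝ (Fin n) → ℝ} (hG : ContDiffOn ℝ (⊤ : ℕ∞) G (Om n))
    {t : ℝ} (ht : 0 < t) (x : EuclideanSpace ℝ (Fin n)) :
    HasDerivAt (fun s => G (s, x)) (fderiv ℝ G (t, x) (1, 0)) t := by
  have h1 := ((cdat hG ht x).differentiableAt (by simp)).hasFDerivAt
  have h2 := h1.comp_hasDerivAt t ((hasDerivAt_id t).prodMk (hasDerivAt_const t x))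
  exact h2

lemma comm_D {n : ℕ} {G : ℝ × EuclideanSpace ℝ (Fin n) → ℝ} (hG : ContDiffOn ℝ (⊤ : ℕ∞) G (Om n))
    {t : ℝ} (ht : 0 < t) (x : EuclideanSpace ℝ (Fin n)) (e e' : ℝ × EuclideanSpace ℝ (Fin n)) :
    fderiv ℝ (fun p => fderiv ℝ G p e) (t, x) e' = fderiv ℝ (fun p => fderiv ℝ G p e') (t, x) e := by
  have hs : IsSymmSndFDerivAt ℝ G (t, x) :=
    (cdat hG ht x).isSymmSndFDerivAt (by simp; exact ENat.LEInfty.out)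
  have hd : DifferentiableAt ℝ (fderiv ℝ G) (t, x) :=
    (((hG.fderiv_of_isOpen (isOpen_Om n) (m := (⊤ : ℕ∞)) (by simp)).contDiffAt
      ((isOpen_Om n).mem_nhds ht)).differentiableAt (by simp))
  have h : ∀ e e', fderiv ℝ (fun p => fderiv ℝ G p e) (t, x) e' =
      fderiv ℝ (fderiv ℝ G) (t, x) e' e := by
    intro e e'
    rw [fderiv_clm_apply hd (differentiableAt_const _)]
    simp
  rw [h, h]
  exact hs _ _

lemma deriv_integral {n : ℕ} {G : ℝ × EuclideanSpace ℝ (Fin n) → ℝ}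
    (hG : ContDiffOn ℝ (⊤ : ℕ∞) G (Om n)) (L : ℝ) {t : ℝ} (ht : 0 < t) :
    HasDerivAt (fun s => ∫ x in cbox n L, G (s, x))
      (∫ x in cbox n L, fderiv ℝ G (t, x) (1, 0)) t := by
  have hcD := cd_D hG (1, 0)
  have hcomp : IsCompact (Set.Icc (t/2) (2*t) ×ˢ cbox n L) := isCompact_Icc.prod (isCompact_cbox n L)
  obtain ⟨M, hM⟩ := hcomp.exists_bound_of_continuousOn (hcD.continuousOn.mono
    (fun p hp => lt_of_lt_of_le (by linarith : 0 < t/2) hp.1.1))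
  refine (hasDerivAt_integral_of_dominated_loc_of_deriv_le (μ := volume.restrict (cbox n L))
    (F := fun s x => G (s, x)) (F' := fun s x => fderiv ℝ G (s, x) (1, 0)) (bound := fun _ => M)
    (s := Set.Icc (t/2) (2*t))
    (Icc_mem_nhds (by linarith) (by linarith)) ?_ ?_ ?_ ?_ ?_ ?_).2
  · filter_upwards [Ioi_mem_nhds ht] with s hs
    exact (slice_cd hG hs).continuous.aestronglyMeasurable
  · exact cont_int (slice_cd hG ht).continuous
  · exact (slice_cd hcD ht).continuous.aestronglyMeasurable
  · exact ae_restrict_of_forall_mem (isCompact_cbox n L).measurableSet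
      fun x hx s hs => hM (s, x) ⟨hs, hx⟩
  · exact cont_int continuous_const
  · exact Filter.Eventually.of_forall fun x s hs =>
      time_D hG (lt_of_lt_of_le (by linarith : 0 < t/2) hs.1) x

lemma cont_integral {n : ℕ} {W : ℝ → EuclideanSpace ℝ (Fin n) → ℝ}
    (hW : ContinuousOn (Function.uncurry W) (Set.Ici 0 ×ˢ Set.univ)) (L : ℝ) :
    ContinuousOn (fun t => ∫ x in cbox n L, W t x) (Set.Ici 0) := by
  have h1 : Continuous (Function.uncurry fun (t : ℝ) (x : EuclideanSpace ℝ (Fin n)) =>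
      W (max t 0) x) := by
    refine hW.comp_continuous (f := fun p : ℝ × EuclideanSpace ℝ (Fin n) => (max p.1 0, p.2))
      (by fun_prop) fun p => ⟨Set.mem_Ici.2 (le_max_right _ _), trivial⟩
  have h2 := continuous_parametric_integral_of_continuous (μ := volume) h1 (isCompact_cbox n L)
  refine h2.continuousOn.congr fun t ht => ?_
  have : max t 0 = t := max_eq_left ht
  simp only [this]

lemma spaceDeriv_continuousOn {n : ℕ} {u : ℝ → EuclideanSpace ℝ (Fin n) → ℝ}
    (hu : ContDiffOn ℝ (⊤ : ℕ∞) (Function.uncurry u) (Set.Ici 0 ×ˢ Set.univ)) (i : Fin n) :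
    ContinuousOn (Function.uncurry fun t x => spaceDeriv (u t) i x) (Set.Ici 0 ×ˢ Set.univ) := by
  have hun : UniqueDiffOn ℝ ((Set.Ici (0:ℝ)) ×ˢ (Set.univ : Set (EuclideanSpace ℝ (Fin n)))) :=
    (uniqueDiffOn_Ici 0).prod uniqueDiffOn_univ
  have h := hu.continuousOn_fderivWithin hun (by simp)
  have h2 := h.clm_apply (continuousOn_const (c := ((0:ℝ), EuclideanSpace.single i (1:ℝ))))
  refine h2.congr ?_
  rintro ⟨t, x⟩ hp
  have h3 := (hu.differentiableOn (by simp) (t, x) hp).hasFDerivWithinAt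
  have h4 := h3.comp x ((hasFDerivAt_prodMk_right t x).hasFDerivWithinAt (s := Set.univ))
    (fun y _ => ⟨hp.1, trivial⟩)
  rw [hasFDerivWithinAt_univ] at h4
  change spaceDeriv (u t) i x = _
  unfold spaceDeriv
  rw [show fderiv ℝ (u t) x = _ from h4.fderiv]
  simp

lemma ut_cd {n : ℕ} {u : ℝ → EuclideanSpace ℝ (Fin n) → ℝ}
    (hu : ContDiffOn ℝ (⊤ : ℕ∞) (Function.uncurry u) (Set.Ici 0 ×ˢ Set.univ)) {t : ℝ} (ht : 0 ≤ t) :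
    ContDiff ℝ (⊤ : ℕ∞) (u t) := by
  rw [← contDiffOn_univ]
  exact hu.comp (f := fun x : EuclideanSpace ℝ (Fin n) => (t, x)) (s := Set.univ)
    (contDiff_const.prodMk contDiff_id).contDiffOn (fun x _ => ⟨ht, trivial⟩)

lemma norm_sq_le {n : ℕ} (A : EuclideanSpace ℝ (Fin n) →L[ℝ] ℝ) :
    ‖A‖ ^ 2 ≤ ∑ i, (A (EuclideanSpace.single i 1)) ^ 2 := by
  have h : ‖A‖ ≤ Real.sqrt (∑ i, (A (EuclideanSpace.single i 1)) ^ 2) := by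
    refine A.opNorm_le_bound (Real.sqrt_nonneg _) fun y => ?_
    have e : A y = ∑ i, A (EuclideanSpace.single i 1) * y i := by
      have : y = ∑ i, y i • EuclideanSpace.single i (1:ℝ) := by
        ext k; simp [Finset.sum_apply, Pi.single_apply]
      conv_lhs => rw [this]
      simp [map_sum, mul_comm]
    rw [e, EuclideanSpace.norm_eq, ← Real.sqrt_mul (by positivity), Real.norm_eq_abs]
    apply Real.abs_le_sqrt
    simp only [Real.norm_eq_abs, sq_abs]
    exact Finset.sum_mul_sq_le_sq_mul_sq _ _ _
  calc ‖A‖ ^ 2 ≤ _ := pow_le_pow_left₀ (norm_nonneg _) h 2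
    _ = _ := Real.sq_sqrt (by positivity)

lemma abs_spaceDeriv_le {n : ℕ} (a : EuclideanSpace ℝ (Fin n) → ℝ) (i : Fin n)
    (x : EuclideanSpace ℝ (Fin n)) : |spaceDeriv a i x| ≤ ‖fderiv ℝ a x‖ := by
  have := (fderiv ℝ a x).le_opNorm (EuclideanSpace.single i 1)
  simpa [spaceDeriv] using this

lemma eta_facts {ε : ℝ} (hε : 0 < ε) :
    ∃ η : ℝ → ℝ, ContDiff ℝ (⊤ : ℕ∞) η ∧ (∀ s, 0 ≤ deriv (deriv η) s) ∧
      (∀ s, deriv (deriv η) s * s ^ 2 ≤ ε) ∧ (∀ s, |s| ≤ η s) ∧ (∀ s, η s ≤ |s| + ε) := by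
  have hpos : ∀ s : ℝ, 0 < s ^ 2 + ε ^ 2 := fun s => by positivity
  have hsq : ∀ s : ℝ, 0 < Real.sqrt (s ^ 2 + ε ^ 2) := fun s => Real.sqrt_pos.2 (hpos s)
  have hd1 : deriv (fun s : ℝ => Real.sqrt (s ^ 2 + ε ^ 2)) =
      fun s => s / Real.sqrt (s ^ 2 + ε ^ 2) := by
    ext s
    have h := (((hasDerivAt_id s).pow 2).add_const (ε^2)).sqrt (hpos s).ne'
    have h' := h.deriv
    refine Eq.trans h' ?_
    simp only [id, Pi.pow_apply]
    have := hsq s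
    field_simp
    norm_num
  have hd2 : ∀ s, deriv (fun s => s / Real.sqrt (s ^ 2 + ε ^ 2)) s =
      ε ^ 2 / ((s ^ 2 + ε ^ 2) * Real.sqrt (s ^ 2 + ε ^ 2)) := by
    intro s
    have h := (((hasDerivAt_id s).pow 2).add_const (ε^2)).sqrt (hpos s).ne'
    have h2 := ((hasDerivAt_id s).div h (hsq s).ne').deriv
    refine Eq.trans h2 ?_
    simp only [id, Pi.pow_apply]
    have h3 := hsq s
    have h4 := hpos s
    have h5 := Real.sq_sqrt h4.le
    rw [h5]
    field_simp
    rw [h5]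
    norm_num
    ring
  refine ⟨fun s => Real.sqrt (s ^ 2 + ε ^ 2), ?_, ?_, ?_, ?_, ?_⟩
  · exact ContDiff.sqrt (by fun_prop) fun s => (hpos s).ne'
  · intro s
    rw [hd1, hd2]
    have := hpos s
    positivity
  · intro s
    rw [hd1, hd2]
    have h3 := hsq s
    have h4 := hpos s
    have h6 : ε ≤ Real.sqrt (s ^ 2 + ε ^ 2) := Real.le_sqrt_of_sq_le (by nlinarith [sq_nonneg s])
    rw [div_mul_eq_mul_div, div_le_iff₀ (by positivity)]
    calc ε ^ 2 * s ^ 2 ≤ ε ^ 2 * (s ^ 2 + ε ^ 2) := by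
          apply mul_le_mul_of_nonneg_left _ (by positivity); nlinarith
      _ = ε * ((s ^ 2 + ε ^ 2) * ε) := by ring
      _ ≤ _ := by gcongr
  · intro s
    exact Real.abs_le_sqrt (by nlinarith)
  · intro s
    apply Real.sqrt_le_iff.2
    refine ⟨by positivity, ?_⟩
    rw [← sq_abs s]
    nlinarith [abs_nonneg s]

lemma uOm {n : ℕ} {u : ℝ → EuclideanSpace ℝ (Fin n) → ℝ}
    (hu : ContDiffOn ℝ (⊤ : ℕ∞) (Function.uncurry u) (Set.Ici 0 ×ˢ Set.univ)) :
    ContDiffOn ℝ (⊤ : ℕ∞) (Function.uncurry u) (Om n) :=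
  hu.mono fun p hp => ⟨Set.mem_Ici.2 (le_of_lt hp), trivial⟩

lemma divFlux_zero {n : ℕ} {f : ℝ → EuclideanSpace ℝ (Fin n)} (hf : Differentiable ℝ f)
    {a : EuclideanSpace ℝ (Fin n) → ℝ} {x : EuclideanSpace ℝ (Fin n)}
    (ha : DifferentiableAt ℝ a x) (h : fderiv ℝ a x = 0) : divFlux f a x = 0 := by
  unfold divFlux
  refine Finset.sum_eq_zero fun i _ => ?_
  have h1 := spaceDeriv_comp (g := fun s => f s i) (flux_comp_diff hf i (a x)).differentiableAt ha i
  refine h1.trans ?_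
  simp [spaceDeriv, h]

lemma laplacian_neg' {n : ℕ} (a : EuclideanSpace ℝ (Fin n) → ℝ) (j : Fin n)
    (x : EuclideanSpace ℝ (Fin n)) :
    spaceDeriv (spaceDeriv (fun y => - a y) j) j x = - spaceDeriv (spaceDeriv a j) j x := by
  have h : ∀ (b : EuclideanSpace ℝ (Fin n) → ℝ), spaceDeriv (fun y => - b y) j =
      fun y => - spaceDeriv b j y := by
    intro b; ext y; unfold spaceDeriv; rw [fderiv_fun_neg]; simp
  rw [h, h]

lemma sol_bound {n : ℕ} {L : ℝ} (hL : 0 < L)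
    {f : ℝ → EuclideanSpace ℝ (Fin n)} (hf : Differentiable ℝ f)
    {ν : ℝ} (hν : 0 < ν) {u : ℝ → EuclideanSpace ℝ (Fin n) → ℝ}
    (hu : ContDiffOn ℝ (⊤ : ℕ∞) (Function.uncurry u) (Set.Ici 0 ×ˢ Set.univ))
    (hp : ∀ t, Per L (u t))
    (hpde : ∀ t x, 0 < t →
            deriv (fun s => u s x) t + divFlux f (u t) x = ν * laplacian (u t) x)
    (h0 : ∀ x, |u 0 x| ≤ 1) (t : ℝ) (ht : 0 ≤ t) (x : EuclideanSpace ℝ (Fin n)) :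
    |u t x| ≤ 1 := by
  have hO := uOm hu
  have hder : ∀ t x, 0 < t → HasDerivAt (fun s => u s x) (deriv (fun s => u s x) t) t :=
    fun t x ht => (time_D hO ht x).differentiableAt.hasDerivAt
  rw [abs_le]
  constructor
  · have := max_principle hL (fun t x => - u t x) hu.continuousOn.neg
      (fun t x i => by simp only [hp t x i]) (fun x => by have := (abs_le.1 (h0 x)).1; linarith)
      (by
        intro t x ht hmax
        refine ⟨- deriv (fun s => u s x) t, ?_, (hder t x ht).neg⟩
        have hcd := ut_cd hu ht.le
        have hmin : IsLocalMin (u t) x := Filter.Eventually.of_forall fun y => by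
          have := hmax y; linarith
        have h1 := divFlux_zero hf (hcd.differentiable (by simp) x) hmin.fderiv_eq_zero
        have h2 := hpde t x ht
        have h3 : 0 ≤ laplacian (u t) x := by
          refine Finset.sum_nonneg fun j _ => ?_
          have := second_deriv_max hcd.neg hmax j
          rw [laplacian_neg'] at this
          linarith
        have := mul_nonneg hν.le h3
        linarith) t ht x
    linarith
  · exact max_principle hL u hu.continuousOn hp (fun x => (abs_le.1 (h0 x)).2)
      (by
        intro t x ht hmax
        refine ⟨deriv (fun s => u s x) t, ?_, hder t x ht⟩
        have hcd := ut_cd hu ht.le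
        have hmin : IsLocalMax (u t) x := Filter.Eventually.of_forall hmax
        have h1 := divFlux_zero hf (hcd.differentiable (by simp) x) hmin.fderiv_eq_zero
        have h2 := hpde t x ht
        have h3 : laplacian (u t) x ≤ 0 :=
          Finset.sum_nonpos fun j _ => second_deriv_max hcd hmax j
        have := mul_nonneg hν.le (neg_nonneg.2 h3)
        linarith) t ht x

lemma energy {n : ℕ} (hn : 1 ≤ n) {K : ℝ} (hK : 0 < K) {L : ℝ} (hL : 0 < L)
    {f : ℝ → EuclideanSpace ℝ (Fin n)} (hf : Differentiable ℝ f)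
    (hl : LipschitzOnWith K.toNNReal f (Set.Icc (-1) 1))
    {ν : ℝ} (hν : 0 < ν) {u : ℝ → EuclideanSpace ℝ (Fin n) → ℝ}
    (hu : ContDiffOn ℝ (⊤ : ℕ∞) (Function.uncurry u) (Set.Ici 0 ×ˢ Set.univ))
    (hp : ∀ t, Per L (u t))
    (hpde : ∀ t x, 0 < t →
            deriv (fun s => u s x) t + divFlux f (u t) x = ν * laplacian (u t) x)
    (h0 : ∀ x, |u 0 x| ≤ 1)
    {η : ℝ → ℝ} (hη : ContDiff ℝ (⊤ : ℕ∞) η) (hη2 : ∀ s, 0 ≤ deriv (deriv η) s) (i : Fin n)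
    (t : ℝ) (ht : 0 < t) :
    ∃ E', HasDerivAt (fun s => ∫ x in cbox n L, η (spaceDeriv (u s) i x)) E' t ∧
      E' ≤ ∫ x in cbox n L, deriv (deriv η) (spaceDeriv (u t) i x) *
        (K ^ 2 * (spaceDeriv (u t) i x) ^ 2 / (2 * ν) -
          ν / 2 * ∑ j, (spaceDeriv (spaceDeriv (u t) i) j x) ^ 2) := by
  have hO := uOm hu
  have hV := cd_D hO (0, EuclideanSpace.single i 1)
  have hT := cd_D hO (1, 0)
  have hG : ContDiffOn ℝ (⊤ : ℕ∞) (fun p => η (fderiv ℝ (Function.uncurry u) p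
      (0, EuclideanSpace.single i 1))) (Om n) := hη.comp_contDiffOn hV
  have hsl : ∀ s, 0 < s → ∀ x, spaceDeriv (u s) i x =
      fderiv ℝ (Function.uncurry u) (s, x) (0, EuclideanSpace.single i 1) :=
    fun s hs x => slice_D hO hs i x
  refine ⟨_, (deriv_integral hG L ht).congr_of_eventuallyEq ?_, ?_⟩
  · filter_upwards [Ioi_mem_nhds ht] with s hs
    congr 1
    ext x
    rw [hsl s hs]
  · have hbt : ∀ x, deriv (fun s => u s x) t = fderiv ℝ (Function.uncurry u) (t, x) (1, 0) :=
      fun x => (time_D hO ht x).deriv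
    have hS := slice hn hK hL.le hf hl hν (a := u t)
      (b := fun x => fderiv ℝ (Function.uncurry u) (t, x) (1, 0)) (ut_cd hu ht.le)
      (slice_cd hT ht) (hp t)
      (fun x k => by
        simp only [← hbt]
        congr 1
        ext s
        exact hp s x k)
      (sol_bound hL hf hν hu hp hpde h0 t ht.le)
      (fun x => by rw [← hbt]; exact hpde t x ht) hη hη2 i
    refine le_trans (le_of_eq ?_) hS
    congr 1
    ext x
    have e1 := time_D hG ht x
    have e2 := (hη.differentiable (by simp) (fderiv ℝ (Function.uncurry u) (t, x)
      (0, EuclideanSpace.single i 1))).hasDerivAt.comp t (time_D hV ht x)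
    rw [e1.unique e2, slice_D hT ht i x, hsl t ht x, comm_D hO ht x]

lemma l1_bound {n : ℕ} (hn : 1 ≤ n) {K : ℝ} (hK : 0 < K) {L : ℝ} (hL : 0 < L)
    {f : ℝ → EuclideanSpace ℝ (Fin n)} (hf : Differentiable ℝ f)
    (hl : LipschitzOnWith K.toNNReal f (Set.Icc (-1) 1))
    {ν : ℝ} (hν : 0 < ν) {u : ℝ → EuclideanSpace ℝ (Fin n) → ℝ}
    (hu : ContDiffOn ℝ (⊤ : ℕ∞) (Function.uncurry u) (Set.Ici 0 ×ˢ Set.univ))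
    (hp : ∀ t, Per L (u t))
    (hpde : ∀ t x, 0 < t →
            deriv (fun s => u s x) t + divFlux f (u t) x = ν * laplacian (u t) x)
    (h0 : ∀ x, |u 0 x| ≤ 1) (i : Fin n)
    (hB : ∫ x in cbox n L, |spaceDeriv (u 0) i x| ≤ 1) (t : ℝ) (ht : 0 ≤ t) :
    ∫ x in cbox n L, |spaceDeriv (u t) i x| ≤ 1 := by
  set vol : ℝ := ∫ _ in cbox n L, (1:ℝ) with hvol
  have hvol0 : 0 ≤ vol := integral_nonneg fun _ => zero_le_one
  have cv : ∀ s, 0 ≤ s → Continuous (spaceDeriv (u s) i) := fun s hs =>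
    (cd_spaceDeriv (ut_cd hu hs) i).continuous
  set c := K ^ 2 / (2 * ν) with hc
  have hc0 : 0 ≤ c := by positivity
  have main : ∀ ε > 0, ∫ x in cbox n L, |spaceDeriv (u t) i x| ≤ 1 + ε * (vol + c * vol * t) := by
    intro ε hε
    obtain ⟨η, hη, hη2, hη3, hη4, hη5⟩ := eta_facts hε
    have hη1c : ContDiff ℝ (⊤ : ℕ∞) (deriv η) := by
      simpa using ContDiff.iterate_deriv 1 hη
    have hη2c : ContDiff ℝ (⊤ : ℕ∞) (deriv (deriv η)) := by
      simpa using ContDiff.iterate_deriv 1 hη1c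
    choose! E' hE1 hE2 using energy hn hK hL hf hl hν hu hp hpde h0 hη hη2 i
    have hcont : ContinuousOn (fun s => ∫ x in cbox n L, η (spaceDeriv (u s) i x)) (Set.Ici 0) :=
      cont_integral (W := fun s x => η (spaceDeriv (u s) i x))
        (hη.continuous.comp_continuousOn (spaceDeriv_continuousOn hu i)) L
    have hE3 : ∀ s, 0 < s → E' s ≤ c * vol * ε := by
      intro s hs
      refine (hE2 s hs).trans ?_
      have : c * vol * ε = ∫ x in cbox n L, (c * ε) * 1 := by
        rw [integral_const_mul]; ring
      rw [this]
      have cs := cv s hs.le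
      have css := fun j => (cd_spaceDeriv (cd_spaceDeriv (ut_cd hu hs.le) i) j).continuous
      have c1 := hη2c.continuous.comp cs
      refine integral_mono (cont_int (c1.mul (by fun_prop))) (cont_int (by fun_prop)) fun x => ?_
      change deriv (deriv η) (spaceDeriv (u s) i x) * _ ≤ _
      have p1 := hη2 (spaceDeriv (u s) i x)
      have p2 := hη3 (spaceDeriv (u s) i x)
      have p3 : 0 ≤ ν / 2 * ∑ j, (spaceDeriv (spaceDeriv (u s) i) j x) ^ 2 := by positivity
      have p4 := mul_nonneg p1 p3
      have p5 := mul_le_mul_of_nonneg_left p2 hc0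
      have p6 : deriv (deriv η) (spaceDeriv (u s) i x) *
          (K ^ 2 * spaceDeriv (u s) i x ^ 2 / (2 * ν)) =
          c * (deriv (deriv η) (spaceDeriv (u s) i x) * spaceDeriv (u s) i x ^ 2) := by
        rw [hc]; ring
      rw [mul_sub, p6]
      linarith
    have hanti : AntitoneOn (fun s => (∫ x in cbox n L, η (spaceDeriv (u s) i x)) -
        c * vol * ε * s) (Set.Ici 0) := by
      have hdd : ∀ s, 0 < s → HasDerivAt (fun s => (∫ x in cbox n L, η (spaceDeriv (u s) i x)) -
        c * vol * ε * s) (E' s - c * vol * ε * 1) s := fun s hs =>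
          (hE1 s hs).sub ((hasDerivAt_id s).const_mul _)
      refine antitoneOn_of_deriv_nonpos (convex_Ici 0) (hcont.sub (by fun_prop)) ?_ ?_
      · intro s hs
        rw [interior_Ici] at hs
        exact (hdd s hs).differentiableAt.differentiableWithinAt
      · intro s hs
        rw [interior_Ici] at hs
        rw [(hdd s hs).deriv]
        have := hE3 s hs
        linarith
    have h1 := hanti (Set.mem_Ici.2 le_rfl) (Set.mem_Ici.2 ht) ht
    simp only [mul_zero, sub_zero] at h1
    have ct := cv t ht
    have c0 := cv 0 le_rfl
    have h2 : ∫ x in cbox n L, |spaceDeriv (u t) i x| ≤ ∫ x in cbox n L, η (spaceDeriv (u t) i x) :=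
      integral_mono (cont_int ct.abs) (cont_int (hη.continuous.comp ct)) fun x => hη4 _
    have h3 : ∫ x in cbox n L, η (spaceDeriv (u 0) i x) ≤
        ∫ x in cbox n L, (|spaceDeriv (u 0) i x| + ε * 1) :=
      integral_mono (cont_int (hη.continuous.comp c0)) (cont_int (c0.abs.add continuous_const))
        fun x => by simpa using hη5 (spaceDeriv (u 0) i x)
    rw [integral_add (cont_int c0.abs) (cont_int continuous_const), integral_const_mul] at h3
    linarith
  by_contra hcon
  push Not at hcon
  set A := vol + c * vol * t with hA
  have hA0 : 0 ≤ A := by positivity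
  set Z := ∫ x in cbox n L, |spaceDeriv (u t) i x|
  have := main ((Z - 1) / (2 * (A + 1))) (by apply div_pos <;> linarith)
  have h2 : (Z - 1) / (2 * (A + 1)) * A ≤ (Z - 1) / 2 := by
    rw [div_mul_eq_mul_div, div_le_div_iff₀ (by linarith) (by norm_num)]
    nlinarith
  linarith

lemma l2_bound {n : ℕ} (hn : 1 ≤ n) {K : ℝ} (hK : 0 < K) {L : ℝ} (hL : 0 < L)
    {f : ℝ → EuclideanSpace ℝ (Fin n)} (hf : Differentiable ℝ f)
    (hl : LipschitzOnWith K.toNNReal f (Set.Icc (-1) 1))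
    {ν : ℝ} (hν : 0 < ν) {u : ℝ → EuclideanSpace ℝ (Fin n) → ℝ}
    (hu : ContDiffOn ℝ (⊤ : ℕ∞) (Function.uncurry u) (Set.Ici 0 ×ˢ Set.univ))
    (hp : ∀ t, Per L (u t))
    (hpde : ∀ t x, 0 < t →
            deriv (fun s => u s x) t + divFlux f (u t) x = ν * laplacian (u t) x)
    (h0 : ∀ x, |u 0 x| ≤ 1) (i : Fin n)
    (hB : ∫ x in cbox n L, |spaceDeriv (u 0) i x| ≤ 1)
    (hE : ∫ x in cbox n L, (spaceDeriv (u 0) i x) ^ 2 ≤ 1) (t : ℝ) (ht : 0 ≤ t) :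
    ∫ x in cbox n L, (spaceDeriv (u t) i x) ^ 2 ≤ 1 + 9 * K / ν := by
  have hη : ContDiff ℝ (⊤ : ℕ∞) (fun s : ℝ => s ^ 2) := by fun_prop
  have d1 : deriv (fun s : ℝ => s ^ 2) = fun s => 2 * s := by ext s; simp
  have d2 : ∀ s, deriv (deriv (fun s : ℝ => s ^ 2)) s = 2 := by
    intro s
    rw [d1]
    simpa using ((hasDerivAt_id s).const_mul (2:ℝ)).deriv
  choose! E' hE1 hE2 using energy hn hK hL hf hl hν hu hp hpde h0 hη
    (fun s => by rw [d2]; norm_num) i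
  have hcont : ContinuousOn (fun s => ∫ x in cbox n L, (spaceDeriv (u s) i x) ^ 2) (Set.Ici 0) :=
    cont_integral (W := fun s x => (spaceDeriv (u s) i x) ^ 2)
      (hη.continuous.comp_continuousOn (spaceDeriv_continuousOn hu i)) L
  have hpos : 0 < 9 * K / ν := by positivity
  refine barrier hcont hE1 (by linarith) ?_ t ht
  intro s hs hM
  have cs := (cd_spaceDeriv (ut_cd hu hs.le) i).continuous
  have css := fun j => (cd_spaceDeriv (cd_spaceDeriv (ut_cd hu hs.le) i) j).continuous
  have hI := interp hn hL.le (ut_cd hu hs.le) (hp s)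
    (sol_bound hL hf hν hu hp hpde h0 s hs.le) i
    (l1_bound hn hK hL hf hl hν hu hp hpde h0 i hB s hs.le)
  have h2 := hE2 s hs
  simp only [d2] at h2
  have e : ∫ x in cbox n L, 2 * (K ^ 2 * (spaceDeriv (u s) i x) ^ 2 / (2 * ν) -
          ν / 2 * ∑ j, (spaceDeriv (spaceDeriv (u s) i) j x) ^ 2) =
      K ^ 2 / ν * (∫ x in cbox n L, (spaceDeriv (u s) i x) ^ 2) -
        ν * ∫ x in cbox n L, ∑ j, (spaceDeriv (spaceDeriv (u s) i) j x) ^ 2 := by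
    rw [← integral_const_mul, ← integral_const_mul,
      ← integral_sub (cont_int (by fun_prop)) (cont_int (by fun_prop))]
    congr 1
    ext x
    field_simp
  rw [e] at h2
  refine h2.trans ?_
  change 1 + 9 * K / ν < ∫ x in cbox n L, (spaceDeriv (u s) i x) ^ 2 at hM
  generalize (∫ x in cbox n L, (spaceDeriv (u s) i x) ^ 2) = E at *
  generalize (∫ x in cbox n L, ∑ j, (spaceDeriv (spaceDeriv (u s) i) j x) ^ 2) = D at *
  have hE9 : 9 * K / ν < E := by linarith
  have hE0 : 0 < E := by linarith
  rw [div_lt_iff₀ hν] at hE9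
  have h81 : 81 * K ^ 2 ≤ (E * ν) ^ 2 := by
    have := pow_le_pow_left₀ (by positivity) hE9.le 2
    nlinarith
  have h3 : ν * E ^ 3 ≤ ν * (72 * D) := mul_le_mul_of_nonneg_left hI hν.le
  have h4 : K ^ 2 / ν * E ≤ ν * E ^ 3 / 72 := by
    rw [div_mul_eq_mul_div, div_le_div_iff₀ hν (by norm_num)]
    have h5 : K ^ 2 * 72 ≤ (E * ν) ^ 2 := by nlinarith [sq_nonneg K]
    nlinarith [mul_le_mul_of_nonneg_left h5 hE0.le]
  linarith

/-- **Theorem (Multi-dimensional conservation laws with Lipschitz flux, on the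
torus `𝕋ⁿ_L`).**  Functions on `𝕋ⁿ_L = (ℝ/Lℤ)ⁿ` are modelled as `L`-periodic
functions on `ℝⁿ`, with integrals over the fundamental domain `[0,L)ⁿ` and the
`L^∞` norm as a supremum over all of `ℝⁿ`.  The constant `C₀` depends only on
`n` and `K`, and in particular is independent of `L ≥ 1`. -/
theorem enstrophy_upper_bound_scalar_conservation_law_torus
    (n : ℕ) (hn : 1 ≤ n) (K : ℝ) (hK : 0 < K) :
    ∃ C₀ : ℝ, 0 < C₀ ∧
      ∀ (L : ℝ), 1 ≤ L →
      ∀ (f : ℝ → EuclideanSpace ℝ (Fin n)),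
        Differentiable ℝ f →
        LipschitzOnWith K.toNNReal f (Set.Icc (-1) 1) →
        ∀ (ν : ℝ), 0 < ν →
        ∀ (u : ℝ → EuclideanSpace ℝ (Fin n) → ℝ),
          ContDiffOn ℝ (⊤ : ℕ∞) (Function.uncurry u) (Set.Ici 0 ×ˢ Set.univ) →
          (∀ t x (i : Fin n), u t (x + L • EuclideanSpace.single i 1) = u t x) →
          (∀ t x, 0 < t →
            deriv (fun s => u s x) t + divFlux f (u t) x = ν * laplacian (u t) x) →
          (∀ x, |u 0 x| ≤ 1) →
          (∫ x in fundamentalBox n L, ‖fderiv ℝ (u 0) x‖) ≤ 1 →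
          (∫ x in fundamentalBox n L, ‖fderiv ℝ (u 0) x‖ ^ 2) ≤ 1 →
          ∀ t, 0 ≤ t →
            (∫ x in fundamentalBox n L, ‖fderiv ℝ (u t) x‖ ^ 2) ≤ C₀ * (1 + ν⁻¹) := by
  refine ⟨n * (1 + 9 * K), by positivity, ?_⟩
  intro L hL1 f hf hl ν hν u hu hp hpde h0 hB hE t ht
  have hL : 0 < L := by linarith
  rw [setIntegral_box] at hB hE ⊢
  have cf : ∀ s, 0 ≤ s → Continuous (fun x => ‖fderiv ℝ (u s) x‖) := fun s hs =>
    ((ut_cd hu hs).continuous_fderiv (by simp)).norm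
  have cs : ∀ s, 0 ≤ s → ∀ i, Continuous (spaceDeriv (u s) i) := fun s hs i =>
    (cd_spaceDeriv (ut_cd hu hs) i).continuous
  have hi : ∀ i, ∫ x in cbox n L, (spaceDeriv (u t) i x) ^ 2 ≤ 1 + 9 * K / ν := by
    intro i
    refine l2_bound hn hK hL hf hl hν hu hp hpde h0 i ?_ ?_ t ht
    · refine le_trans (integral_mono (cont_int (cs 0 le_rfl i).abs) (cont_int (cf 0 le_rfl))
        fun x => abs_spaceDeriv_le _ i x) hB
    · refine le_trans (integral_mono (cont_int ((cs 0 le_rfl i).pow 2))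
        (cont_int ((cf 0 le_rfl).pow 2)) fun x => ?_) hE
      have := pow_le_pow_left₀ (abs_nonneg _) (abs_spaceDeriv_le (u 0) i x) 2
      rw [sq_abs] at this
      exact this
  have h1 : ∫ x in cbox n L, ‖fderiv ℝ (u t) x‖ ^ 2 ≤
      ∫ x in cbox n L, ∑ i, (spaceDeriv (u t) i x) ^ 2 :=
    integral_mono (cont_int ((cf t ht).pow 2))
      (cont_int (continuous_finsetSum _ fun i _ => (cs t ht i).pow 2)) fun x => norm_sq_le _
  have hint : ∀ i ∈ (Finset.univ : Finset (Fin n)),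
      Integrable (fun x => (spaceDeriv (u t) i x) ^ 2) (volume.restrict (cbox n L)) :=
    fun i _ => cont_int ((cs t ht i).pow 2)
  rw [integral_finsetSum _ hint] at h1
  have h2 := Finset.sum_le_sum fun i (_ : i ∈ Finset.univ) => hi i
  rw [Finset.sum_const, Finset.card_univ, Fintype.card_fin, nsmul_eq_mul] at h2
  refine h1.trans (h2.trans ?_)
  rw [mul_assoc]
  refine mul_le_mul_of_nonneg_left ?_ (by positivity)
  have : 0 < ν⁻¹ := by positivity
  rw [div_eq_mul_inv]
  nlinarith
end

section
/- For every n ≥ 1 there exists a constant C > 0, depending only on n, such that for every ν > 0, t > 0, and every bounded function v₀ ∈ W^{1,1}(ℝⁿ), the function w := Φ_{νt} ∗ v₀ satisfies ‖∇²w‖_{L²(ℝⁿ)} ≤ C (νt)^{-3/4} ‖v₀‖_{L^∞}^{1/2} ‖∇v₀‖_{L¹}^{1/2}, where ∇²w denotes the Hessian of w. -/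
open MeasureTheory

/-- The heat kernel `Φ_s(x) = (4πs)^{-n/2} exp(-|x|²/(4s))` on `ℝⁿ`. -/
noncomputable def heatKernel (n : ℕ) (s : ℝ) (x : EuclideanSpace ℝ (Fin n)) : ℝ :=
  (4 * Real.pi * s) ^ (-(n : ℝ) / 2) * Real.exp (-‖x‖ ^ 2 / (4 * s))

/-- The heat evolution `(Φ_s ∗ v)(x) = ∫ Φ_s(x − y) v(y) dy`, representing `e^{sΔ}v`. -/
noncomputable def heatConv {n : ℕ} (s : ℝ) (v : EuclideanSpace ℝ (Fin n) → ℝ)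
    (x : EuclideanSpace ℝ (Fin n)) : ℝ :=
  ∫ y, heatKernel n s (x - y) * v y


section HeatAux

set_option maxSynthPendingDepth 3

theorem heatAux_integrable {E : Type*} [NormedAddCommGroup E] [InnerProductSpace ℝ E] [FiniteDimensional ℝ E]
    [MeasurableSpace E] [BorelSpace E] {F : Type*} [NormedAddCommGroup F] [NormedSpace ℝ F]
    (K : E → F) (hK : Continuous K) (B : ℝ) (hB : ∀ x, ‖K x‖ ≤ B)
    (v : E → ℝ) (hv : Integrable v) (x : E) :
    Integrable (fun y => v y • K (x - y)) := by
  refine Integrable.smul_bdd (f := fun y => K (x - y)) hv B ?_ (Filter.Eventually.of_forall fun y => hB _)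
  exact (hK.comp (continuous_const.sub continuous_id)).aestronglyMeasurable

theorem heatAux_hasFDerivAt {E : Type*} [NormedAddCommGroup E] [InnerProductSpace ℝ E] [FiniteDimensional ℝ E]
    [MeasurableSpace E] [BorelSpace E] {F : Type*} [NormedAddCommGroup F] [NormedSpace ℝ F]
    (K : E → F) (K' : E → E →L[ℝ] F)
    (hK' : Continuous K') (hd : ∀ x, HasFDerivAt K (K' x) x)
    (B B' : ℝ) (hB : ∀ x, ‖K x‖ ≤ B) (hB' : ∀ x, ‖K' x‖ ≤ B')
    (v : E → ℝ) (hv : Integrable v) (x : E) :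
    HasFDerivAt (fun x => ∫ y, v y • K (x - y)) (∫ y, v y • K' (x - y)) x := by
  have hK : Continuous K := continuous_iff_continuousAt.2 fun x => (hd x).continuousAt
  refine hasFDerivAt_integral_of_dominated_of_fderiv_le (𝕜 := ℝ) (s := Set.univ)
    (bound := fun y => |v y| * B') (F := fun x y => v y • K (x - y))
    (F' := fun x y => v y • K' (x - y)) Filter.univ_mem
    (Filter.Eventually.of_forall fun z => (heatAux_integrable K hK B hB v hv z).aestronglyMeasurable)
    (heatAux_integrable K hK B hB v hv x)
    (heatAux_integrable K' hK' B' hB' v hv x).aestronglyMeasurable ?_ (hv.abs.mul_const _) ?_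
  · refine Filter.Eventually.of_forall fun y z _ => ?_
    rw [norm_smul, Real.norm_eq_abs]
    gcongr
    exact hB' _
  · refine Filter.Eventually.of_forall fun y z _ => ?_
    have h1 := (hd (z - y)).comp z ((hasFDerivAt_id z).sub_const y)
    exact (h1.const_smul (v y))

theorem heatAux_abstract {E : Type*} [NormedAddCommGroup E] [InnerProductSpace ℝ E] [FiniteDimensional ℝ E]
    [MeasurableSpace E] [BorelSpace E]
    (K : E → ℝ)
    (K1 : E → E →L[ℝ] ℝ)
    (K2 : E → E →L[ℝ] E →L[ℝ] ℝ)
    (hK2 : Continuous K2) (hd : ∀ x, HasFDerivAt K (K1 x) x) (hd1 : ∀ x, HasFDerivAt K1 (K2 x) x)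
    (g : E → ℝ) (hg : Integrable g) (b0 b1 b2 c : ℝ)
    (hb1 : 0 ≤ b1) (hb2 : 0 ≤ b2)
    (h0 : ∀ x, ‖K x‖ ≤ b0) (hgc : ∀ x, g x ≤ c)
    (h1 : ∀ x, ‖K1 x‖ ≤ b1 * g x) (h2 : ∀ x, ‖K2 x‖ ≤ b2 * g x)
    (v : E → ℝ) (M : ℝ) (hvd : Differentiable ℝ v) (hv : Integrable v)
    (hv' : Integrable (fun x => ‖fderiv ℝ v x‖)) (hM : ∀ x, |v x| ≤ M) :
    ∫ x, ‖fderiv ℝ (fderiv ℝ (fun x => ∫ y, v y • K (x - y))) x‖ ^ 2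
      ≤ (M * (b2 * ∫ x, g x)) * ((∫ x, ‖fderiv ℝ v x‖) * (b1 * ∫ x, g x)) := by
  have hK1 : Continuous K1 := continuous_iff_continuousAt.2 fun x => (hd1 x).continuousAt
  have hM0 : 0 ≤ M := (abs_nonneg _).trans (hM 0)
  have B1 : ∀ x, ‖K1 x‖ ≤ b1 * c := fun x => (h1 x).trans (by gcongr; exact hgc x)
  have B2 : ∀ x, ‖K2 x‖ ≤ b2 * c := fun x => (h2 x).trans (by gcongr; exact hgc x)
  have e1 : fderiv ℝ (fun x => ∫ y, v y • K (x - y)) = fun x => ∫ y, v y • K1 (x - y) :=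
    funext fun x => (heatAux_hasFDerivAt K K1 hK1 hd b0 (b1 * c) h0 B1 v hv x).fderiv
  have e2 : fderiv ℝ (fun x => ∫ y, v y • K1 (x - y)) = fun x => ∫ y, v y • K2 (x - y) :=
    funext fun x => (heatAux_hasFDerivAt K1 K2 hK2 hd1 _ _ B1 B2 v hv x).fderiv
  rw [e1, e2]
  have hDv : Integrable (fderiv ℝ v) :=
    (integrable_norm_iff (measurable_fderiv ℝ v).aestronglyMeasurable).1 hv'
  have gi : ∀ x, Integrable (fun y => g (x - y)) := fun x => hg.comp_sub_left x
  -- sup bound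
  have S : ∀ x, ‖∫ y, v y • K2 (x - y)‖ ≤ M * (b2 * ∫ x, g x) := by
    intro x
    have : ∫ y, M * (b2 * g (x - y)) = M * (b2 * ∫ x, g x) := by
      rw [integral_const_mul, integral_const_mul, integral_sub_left_eq_self g volume x]
    rw [← this]
    refine norm_integral_le_of_norm_le (((gi x).const_mul _).const_mul _)
      (Filter.Eventually.of_forall fun y => ?_)
    rw [norm_smul, Real.norm_eq_abs]
    exact mul_le_mul (hM _) (h2 _) (norm_nonneg _) hM0
  set G : E → ℝ :=
    convolution (fun y => ‖fderiv ℝ v y‖) (fun y => b1 * g y) (ContinuousLinearMap.mul ℝ ℝ) volume with hG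
  have Gi : Integrable G := Integrable.integrable_convolution _ hv' (hg.const_mul _)
  have GI : ∫ x, G x = (∫ x, ‖fderiv ℝ v x‖) * (b1 * ∫ x, g x) := by
    rw [hG, integral_convolution _ hv' (hg.const_mul _)]
    simp [integral_const_mul]
  have G0 : ∀ x, 0 ≤ G x := by
    intro x
    refine integral_nonneg fun y => ?_
    exact mul_nonneg (norm_nonneg _) ((norm_nonneg _).trans (h1 _))
  have L : ∀ᵐ x, ‖∫ y, v y • K2 (x - y)‖ ≤ G x := by
    have hci := (Integrable.convolution_integrand (ContinuousLinearMap.mul ℝ ℝ)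
      (μ := volume) (ν := volume) hv' (hg.const_mul b1)).prod_right_ae
    filter_upwards [hci] with x hx
    refine ContinuousLinearMap.opNorm_le_bound _ (G0 x) fun h => ?_
    rw [ContinuousLinearMap.integral_apply (heatAux_integrable K2 hK2 _ B2 v hv x)]
    have hdx : ∀ y, HasFDerivAt (fun y => K1 (x - y)) (-(K2 (x - y))) y := by
      intro y
      have := (hd1 (x - y)).comp y ((hasFDerivAt_id y).const_sub x)
      have e3 : (K2 (x - y)).comp (-ContinuousLinearMap.id ℝ E) = -(K2 (x - y)) := by
        ext; simp
      rw [← e3]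
      exact this
    have i1 : Integrable (fun y => (fderiv ℝ v y h) • K1 (x - y)) :=
      heatAux_integrable K1 hK1 _ B1 _ (hDv.apply_continuousLinearMap h) x
    have i2 : Integrable (fun y => v y • (-(K2 (x - y))) h) := by
      have := ((heatAux_integrable K2 hK2 _ B2 v hv x).apply_continuousLinearMap h).neg
      refine this.congr (Filter.Eventually.of_forall fun y => ?_)
      simp
    have ibp := integral_bilinear_hasFDerivAt_right_eq_neg_left_of_integrable
      (μ := (volume : Measure E))
      (f := v) (f' := fderiv ℝ v) (g := fun y => K1 (x - y)) (g' := fun y => -(K2 (x - y)))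
      (v := h) (B := ContinuousLinearMap.lsmul ℝ ℝ) i1 i2
      (heatAux_integrable K1 hK1 _ B1 v hv x) (fun y _ => (hvd y).hasFDerivAt) (fun y _ => hdx y)
    have key : ∫ y, (v y • K2 (x - y)) h = ∫ y, (fderiv ℝ v y h) • K1 (x - y) := by
      have : ∫ y, (v y • K2 (x - y)) h = - ∫ y, v y • (-(K2 (x - y))) h := by
        rw [← integral_neg]; congr 1; ext y; simp
      rw [this]
      simp only [ContinuousLinearMap.lsmul_apply] at ibp
      rw [ibp, neg_neg]
    rw [key, hG, convolution, ← integral_mul_const]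
    refine norm_integral_le_of_norm_le (hx.mul_const _) (Filter.Eventually.of_forall fun y => ?_)
    rw [norm_smul]
    calc ‖fderiv ℝ v y h‖ * ‖K1 (x - y)‖ ≤ (‖fderiv ℝ v y‖ * ‖h‖) * (b1 * g (x - y)) :=
          mul_le_mul ((fderiv ℝ v y).le_opNorm h) (h1 _) (norm_nonneg _) (by positivity)
      _ = _ := by simp; ring
  calc _ ≤ ∫ x, (M * (b2 * ∫ x, g x)) * G x := by
        refine integral_mono_of_nonneg (Filter.Eventually.of_forall fun x => by positivity)
          (Gi.const_mul _) ?_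
        filter_upwards [L] with x hx
        rw [sq]
        exact mul_le_mul (S x) hx (norm_nonneg _) ((norm_nonneg _).trans (S x))
    _ = _ := by rw [integral_const_mul, GI]

noncomputable def heatAuxJ (E : Type*) [NormedAddCommGroup E] [InnerProductSpace ℝ E] :
    E →L[ℝ] E →L[ℝ] ℝ := innerSL ℝ

theorem heatAuxJ_norm {E : Type*} [NormedAddCommGroup E] [InnerProductSpace ℝ E] (x : E) : ‖heatAuxJ E x‖ = ‖x‖ :=
  innerSL_apply_norm ℝ x

theorem heatAuxJ_norm_le (E : Type*) [NormedAddCommGroup E] [InnerProductSpace ℝ E] : ‖heatAuxJ E‖ ≤ 1 :=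
  ContinuousLinearMap.opNorm_le_bound _ zero_le_one fun x => by rw [heatAuxJ_norm, one_mul]

theorem heatAux_exp (u : ℝ) : u * Real.exp (-u ^ 2) ≤ Real.exp (-u ^ 2 / 2) ∧
    (2 + 4 * u ^ 2) * Real.exp (-u ^ 2) ≤ 10 * Real.exp (-u ^ 2 / 2) := by
  have h : Real.exp (-u ^ 2 / 2) = Real.exp (u ^ 2 / 2) * Real.exp (-u ^ 2) := by
    rw [← Real.exp_add]; congr 1; ring
  have h2 := Real.add_one_le_exp (u ^ 2 / 2)
  rw [h, ← mul_assoc]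
  constructor <;> gcongr <;> nlinarith [sq_nonneg (u - 1), sq_nonneg u]

theorem heatAux_gauss {E : Type*} [NormedAddCommGroup E] [InnerProductSpace ℝ E] [FiniteDimensional ℝ E]
    [MeasurableSpace E] [BorelSpace E] (a c : ℝ) (ha : 0 < a) (hc : 0 ≤ c)
    (v : E → ℝ) (M : ℝ) (hvd : Differentiable ℝ v) (hv : Integrable v)
    (hv' : Integrable (fun x => ‖fderiv ℝ v x‖)) (hM : ∀ x, |v x| ≤ M) :
    ∫ x, ‖fderiv ℝ (fderiv ℝ (fun x => ∫ y, v y • (c * Real.exp (-a * ‖x - y‖ ^ 2)))) x‖ ^ 2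
      ≤ (M * (10 * a * (c * (Real.pi / (a / 2)) ^ ((Module.finrank ℝ E : ℝ) / 2)))) *
        ((∫ x, ‖fderiv ℝ v x‖) * (2 * √a * (c * (Real.pi / (a / 2)) ^ ((Module.finrank ℝ E : ℝ) / 2)))) := by
  set K : E → ℝ := fun x => c * Real.exp (-a * ‖x‖ ^ 2) with hK
  set K1 : E → E →L[ℝ] ℝ :=
    fun x => (-2 * a * K x) • heatAuxJ E x with hK1
  set K2 : E → E →L[ℝ] E →L[ℝ] ℝ :=
    fun x => (-2 * a * K x) • heatAuxJ E + ((-2 * a) • K1 x).smulRight (heatAuxJ E x) with hK2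
  set g : E → ℝ := fun x => c * Real.exp (-(a / 2) * ‖x‖ ^ 2) with hg
  have K0 : ∀ x, 0 ≤ K x := fun x => by positivity
  have d0 : ∀ x, HasFDerivAt K (K1 x) x := by
    intro x
    have h : HasFDerivAt (fun x : E => ‖x‖ ^ 2) (2 • heatAuxJ E x) x :=
      (hasStrictFDerivAt_norm_sq x).hasFDerivAt
    have := (((h.const_mul (-a)).exp).const_mul c)
    have e3 : c • Real.exp (-a * ‖x‖ ^ 2) • -a • 2 • (heatAuxJ E) x = K1 x := by
      ext y
      simp [hK1, hK]; ring
    rw [← e3]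
    exact this
  have d1 : ∀ x, HasFDerivAt K1 (K2 x) x := by
    intro x
    have := ((d0 x).const_mul (-2 * a)).smul (heatAuxJ E).hasFDerivAt
    exact this
  have cK : Continuous K := continuous_iff_continuousAt.2 fun x => (d0 x).continuousAt
  have cK1 : Continuous K1 := continuous_iff_continuousAt.2 fun x => (d1 x).continuousAt
  have cK2 : Continuous K2 := by
    have : Continuous fun x => ((-2 * a) • K1 x).smulRight (heatAuxJ E x) :=
      ((ContinuousLinearMap.smulRightL ℝ E (E →L[ℝ] ℝ)).continuous₂).comp
        ((cK1.const_smul (-2 * a)).prodMk (heatAuxJ E).continuous)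
    exact ((continuous_const.mul cK).smul continuous_const).add this
  have hI : ∫ x : E, Real.exp (-(a / 2) * ‖x‖ ^ 2)
      = (Real.pi / (a / 2)) ^ ((Module.finrank ℝ E : ℝ) / 2) := by
    rw [GaussianFourier.integral_rexp_neg_mul_sq_norm (by positivity)]
  have hgi : Integrable g := by
    refine Integrable.const_mul (Integrable.of_integral_ne_zero ?_) c
    rw [hI]
    have := Real.pi_pos
    positivity
  have hgI : ∫ x, g x = c * (Real.pi / (a / 2)) ^ ((Module.finrank ℝ E : ℝ) / 2) := by
    rw [hg, integral_const_mul, hI]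
  have sq_a : √a ^ 2 = a := Real.sq_sqrt ha.le
  have Q : ∀ x : E,
      -(√a * ‖x‖) ^ 2 = -a * ‖x‖ ^ 2 := fun x => by rw [mul_pow, sq_a]; ring
  have Q' : ∀ x : E,
      -(√a * ‖x‖) ^ 2 / 2 = -(a / 2) * ‖x‖ ^ 2 := fun x => by rw [Q]; ring
  have n1 : ∀ x, ‖K1 x‖ = 2 * a * K x * ‖x‖ := by
    intro x
    rw [hK1, norm_smul, heatAuxJ_norm, Real.norm_eq_abs, abs_mul, abs_mul, abs_of_nonneg (K0 x),
      abs_of_pos ha]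
    norm_num
  rw [← hgI]
  refine heatAux_abstract K K1 K2 cK2 d0 d1 g hgi c (2 * √a) (10 * a) c (by positivity)
    (by positivity) ?_ ?_ ?_ ?_ v M hvd hv hv' hM
  · intro x
    rw [Real.norm_eq_abs, abs_of_nonneg (K0 x)]
    refine mul_le_of_le_one_right hc (Real.exp_le_one_iff.2 ?_)
    nlinarith [sq_nonneg ‖x‖]
  · intro x
    refine mul_le_of_le_one_right hc (Real.exp_le_one_iff.2 ?_)
    nlinarith [sq_nonneg ‖x‖]
  · intro x
    rw [n1]
    have := (heatAux_exp (√a * ‖x‖)).1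
    rw [Q', Q] at this
    calc 2 * a * K x * ‖x‖ = 2 * √a * c * (√a * ‖x‖ * Real.exp (-a * ‖x‖ ^ 2)) := by
          rw [hK]; nth_rw 1 [← sq_a]; ring
      _ ≤ 2 * √a * c * Real.exp (-(a / 2) * ‖x‖ ^ 2) := by gcongr
      _ = _ := by rw [hg]; ring
  · intro x
    have := (heatAux_exp (√a * ‖x‖)).2
    rw [Q', Q, mul_pow, sq_a] at this
    have hn1 : ‖(-2 * a * K x) • heatAuxJ E‖ ≤ 2 * a * K x := by
      rw [norm_smul, Real.norm_eq_abs, abs_mul, abs_mul, abs_of_nonneg (K0 x), abs_of_pos ha]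
      norm_num
      exact mul_le_of_le_one_right (mul_nonneg (by positivity) (K0 x)) (heatAuxJ_norm_le E)
    have hn2 : ‖((-2 * a) • K1 x).smulRight (heatAuxJ E x)‖ = 4 * a ^ 2 * K x * ‖x‖ ^ 2 := by
      rw [ContinuousLinearMap.norm_smulRight_apply, norm_smul, n1, heatAuxJ_norm, Real.norm_eq_abs,
        abs_mul, abs_of_pos ha]
      norm_num
      ring
    calc ‖K2 x‖ ≤ 2 * a * K x + 4 * a ^ 2 * K x * ‖x‖ ^ 2 :=
          (norm_add_le _ _).trans (add_le_add hn1 hn2.le)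
      _ = a * c * ((2 + 4 * (a * ‖x‖ ^ 2)) * Real.exp (-a * ‖x‖ ^ 2)) := by rw [hK]; ring
      _ ≤ a * c * (10 * Real.exp (-(a / 2) * ‖x‖ ^ 2)) := by gcongr
      _ = _ := by rw [hg]; ring

end HeatAux

/-- **Lemma (heat estimate `‖∇²e^{νtΔ}v₀‖_{L²} ≲ (νt)^{-3/4} ‖v₀‖_∞^{1/2} ‖∇v₀‖_{L¹}^{1/2}`).**
The `L^∞` norm of `v₀` is represented by an arbitrary pointwise bound `M`. -/
theorem heat_hessian_L2_estimate (n : ℕ) (hn : 1 ≤ n) :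
    ∃ C : ℝ, 0 < C ∧
      ∀ (ν t : ℝ), 0 < ν → 0 < t →
      ∀ (v₀ : EuclideanSpace ℝ (Fin n) → ℝ) (M : ℝ),
        Differentiable ℝ v₀ →
        Integrable v₀ →
        Integrable (fun x => ‖fderiv ℝ v₀ x‖) →
        (∀ x, |v₀ x| ≤ M) →
        Real.sqrt (∫ x, ‖fderiv ℝ (fderiv ℝ (heatConv (ν * t) v₀)) x‖ ^ 2)
          ≤ C * (ν * t) ^ (-(3 : ℝ) / 4) * Real.sqrt M *
            Real.sqrt (∫ x, ‖fderiv ℝ v₀ x‖) := by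
  refine ⟨√20 * 2 ^ ((n : ℝ) / 2), by positivity, ?_⟩
  intro ν t hν ht v M hvd hv hv' hM
  have hs : 0 < ν * t := mul_pos hν ht
  generalize ν * t = s at hs
  have hpi := Real.pi_pos
  have hM0 : 0 ≤ M := (abs_nonneg _).trans (hM 0)
  have hD : 0 ≤ ∫ x, ‖fderiv ℝ v x‖ := integral_nonneg fun x => norm_nonneg _
  have e : heatConv s v = fun x => ∫ y, v y •
      ((4 * Real.pi * s) ^ (-(n : ℝ) / 2) * Real.exp (-(1 / (4 * s)) * ‖x - y‖ ^ 2)) := by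
    ext x
    simp only [heatConv, heatKernel, smul_eq_mul]
    congr 1
    ext y
    rw [mul_comm]
    congr 3
    ring
  have hA : (4 * Real.pi * s) ^ (-(n : ℝ) / 2) * (Real.pi / (1 / (4 * s) / 2)) ^ ((n : ℝ) / 2)
      = 2 ^ ((n : ℝ) / 2) := by
    have : Real.pi / (1 / (4 * s) / 2) = (4 * Real.pi * s) * 2 := by field_simp
    rw [this, Real.mul_rpow (x := 4 * Real.pi * s) (y := 2) (by positivity) (by norm_num), ← mul_assoc,
      ← Real.rpow_add (by positivity)]
    have : -(n : ℝ) / 2 + (n : ℝ) / 2 = 0 := by ring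
    rw [this, Real.rpow_zero, one_mul]
  have main := heatAux_gauss (1 / (4 * s)) ((4 * Real.pi * s) ^ (-(n : ℝ) / 2)) (by positivity)
    (by positivity) v M hvd hv hv' hM
  rw [finrank_euclideanSpace_fin, hA, ← e] at main
  refine Real.sqrt_le_iff.2 ⟨by positivity, main.trans ?_⟩
  set A : ℝ := 2 ^ ((n : ℝ) / 2)
  have hp : (s ^ (-(3 : ℝ) / 4)) ^ 2 = s⁻¹ * √s⁻¹ := by
    rw [← Real.rpow_natCast, ← Real.rpow_mul hs.le, Real.sqrt_eq_rpow, ← Real.rpow_neg_one,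
      ← Real.rpow_mul hs.le, ← Real.rpow_add hs]
    norm_num
  have h1 : 1 / (4 * s) ≤ s⁻¹ := by
    rw [← one_div]; exact one_div_le_one_div_of_le hs (by linarith)
  calc _ ≤ M * (10 * s⁻¹ * A) * ((∫ x, ‖fderiv ℝ v x‖) * (2 * √s⁻¹ * A)) := by
        gcongr
    _ = _ := by
        rw [mul_pow, mul_pow, mul_pow, mul_pow, hp, Real.sq_sqrt hM0, Real.sq_sqrt hD,
          Real.sq_sqrt (by norm_num)]
        ring
end

section
/- Let n ≥ 1, K > 0, ν > 0, and let f : ℝ → ℝⁿ be differentiable and Lipschitz continuous on [-1,1] with Lipschitz constant at most K. Let u : [0,∞) × ℝⁿ → ℝ be a smooth solution of ∂ₜu + div(f(u)) = ν Δu on (0,∞) × ℝⁿ such that ‖u(t,·)‖_{L^∞} ≤ 1 and ∇u(t,·), Δu(t,·) ∈ L²(ℝⁿ) for all t ≥ 0, with t ↦ ∫ |∇u(t,x)|² dx differentiable. Then for every t > 0, (d/dt) (1/2) ∫_{ℝⁿ} |∇u(t,x)|² dx ≤ (K²/(2ν)) ∫_{ℝⁿ} |∇u(t,x)|² dx − (ν/2)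 ∫_{ℝⁿ} |Δu(t,x)|² dx. -/
open MeasureTheory

section Helpers

open Filter Topology Set

/-- Directional derivative. -/
noncomputable def dirD {X : Type*} [NormedAddCommGroup X] [NormedSpace ℝ X] (e : X) (F : X → ℝ) (p : X) : ℝ :=
  fderiv ℝ F p e

lemma dirD_contDiff {X : Type*} [NormedAddCommGroup X] [NormedSpace ℝ X] (e : X) {F : X → ℝ}
    (hF : ContDiff ℝ (⊤ : ℕ∞) F) : ContDiff ℝ (⊤ : ℕ∞) (dirD e F) := by
  have h : ContDiff ℝ (⊤ : ℕ∞) (fderiv ℝ F) := hF.fderiv_right (by simp)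
  exact h.clm_apply contDiff_const

lemma dirD_comm {X : Type*} [NormedAddCommGroup X] [NormedSpace ℝ X] (e e' : X) {F : X → ℝ}
    (hF : ContDiff ℝ (⊤ : ℕ∞) F) (p : X) : dirD e (dirD e' F) p = dirD e' (dirD e F) p := by
  have h : ContDiff ℝ (⊤ : ℕ∞) (fderiv ℝ F) := hF.fderiv_right (by simp)
  have hd : DifferentiableAt ℝ (fderiv ℝ F) p := (h.differentiable (by simp)) p
  have key : ∀ a b : X, dirD a (dirD b F) p = fderiv ℝ (fderiv ℝ F) p a b := by
    intro a b
    have h1 : HasFDerivAt (fun q => fderiv ℝ F q b) _ p := hd.hasFDerivAt.clm_apply (hasFDerivAt_const b p)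
    have : dirD b F = fun q => fderiv ℝ F q b := rfl
    unfold dirD at *
    rw [h1.fderiv]
    simp
  rw [key, key]
  exact (hF.contDiffAt.isSymmSndFDerivAt (by simp; exact WithTop.coe_le_coe.2 le_top)) e e'

variable {n : ℕ}

lemma dual_norm_sq_sum (L : EuclideanSpace ℝ (Fin n) →L[ℝ] ℝ) :
    ‖L‖ ^ 2 = ∑ i, (L (EuclideanSpace.single i 1)) ^ 2 := by
  have := (EuclideanSpace.basisFun (Fin n) ℝ).norm_dual L
  simpa using this

lemma slice_spaceDeriv {F : ℝ × EuclideanSpace ℝ (Fin n) → ℝ} (hF : ContDiff ℝ (⊤ : ℕ∞) F)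
    (s : ℝ) (i : Fin n) (x : EuclideanSpace ℝ (Fin n)) :
    spaceDeriv (fun y => F (s, y)) i x = dirD ((0 : ℝ), EuclideanSpace.single i (1 : ℝ)) F (s, x) := by
  have hd : DifferentiableAt ℝ F (s, x) := (hF.differentiable (by simp)) _
  have h2 := hd.hasFDerivAt.comp x (hasFDerivAt_prodMk_right (𝕜 := ℝ) s x)
  have h3 : HasFDerivAt (fun y => F (s, y)) _ x := h2
  unfold spaceDeriv dirD
  rw [h3.fderiv]
  simp

lemma slice_hasDerivAt {F : ℝ × EuclideanSpace ℝ (Fin n) → ℝ} (hF : ContDiff ℝ (⊤ : ℕ∞) F)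
    (s : ℝ) (x : EuclideanSpace ℝ (Fin n)) :
    HasDerivAt (fun r => F (r, x)) (dirD ((1 : ℝ), (0 : EuclideanSpace ℝ (Fin n))) F (s, x)) s := by
  have hd : DifferentiableAt ℝ F (s, x) := (hF.differentiable (by simp)) _
  have h2 := hd.hasFDerivAt.comp s (hasFDerivAt_prodMk_left (𝕜 := ℝ) s x)
  have h3 : HasFDerivAt (fun r => F (r, x)) _ s := h2
  have := h3.hasDerivAt
  simpa [dirD] using this

lemma slice_laplacian {F : ℝ × EuclideanSpace ℝ (Fin n) → ℝ} (hF : ContDiff ℝ (⊤ : ℕ∞) F)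
    (s : ℝ) (x : EuclideanSpace ℝ (Fin n)) :
    laplacian (fun y => F (s, y)) x = ∑ i, dirD ((0 : ℝ), EuclideanSpace.single i (1 : ℝ))
      (dirD ((0 : ℝ), EuclideanSpace.single i (1 : ℝ)) F) (s, x) := by
  unfold laplacian
  refine Finset.sum_congr rfl fun i _ => ?_
  have : spaceDeriv (fun y => F (s, y)) i = fun y => dirD ((0 : ℝ), EuclideanSpace.single i (1 : ℝ)) F (s, y) :=
    funext fun y => slice_spaceDeriv hF s i y
  rw [this, slice_spaceDeriv (dirD_contDiff _ hF)]

lemma hasDerivAt_param {G : ℝ × EuclideanSpace ℝ (Fin n) → ℝ} (hG : ContDiff ℝ (⊤ : ℕ∞) G)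
    {k : Set (EuclideanSpace ℝ (Fin n))} (hk : IsCompact k) (hGk : ∀ s x, x ∉ k → G (s, x) = 0) (t : ℝ) :
    HasDerivAt (fun s => ∫ x, G (s, x))
      (∫ x, dirD ((1 : ℝ), (0 : EuclideanSpace ℝ (Fin n))) G (t, x)) t := by
  have hc' := (dirD_contDiff ((1 : ℝ), (0 : EuclideanSpace ℝ (Fin n))) hG).continuous
  obtain ⟨C, hC⟩ := ((isCompact_Icc (a := t - 1) (b := t + 1)).prod hk).exists_bound_of_continuousOn
    hc'.continuousOn
  have h0 : ∀ s x, x ∉ k → dirD ((1 : ℝ), (0 : EuclideanSpace ℝ (Fin n))) G (s, x) = 0 := by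
    intro s x hx
    have h := slice_hasDerivAt hG s x
    have h' : (fun r => G (r, x)) = fun _ => 0 := funext fun r => hGk r x hx
    rw [h'] at h
    exact h.unique (hasDerivAt_const s 0)
  have := hasDerivAt_integral_of_dominated_loc_of_deriv_le (μ := volume)
    (F := fun s x => G (s, x)) (x₀ := t) (s := Icc (t - 1) (t + 1))
    (F' := fun s x => dirD ((1 : ℝ), (0 : EuclideanSpace ℝ (Fin n))) G (s, x))
    (bound := k.indicator fun _ => C)
    (Icc_mem_nhds (by linarith) (by linarith))
    (Eventually.of_forall fun s => (hG.continuous.comp (by fun_prop)).aestronglyMeasurable)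
    ((hG.continuous.comp (by fun_prop : Continuous fun x => (t, x))).integrable_of_hasCompactSupport
      (HasCompactSupport.intro hk (fun x hx => hGk t x hx)))
    (hc'.comp (by fun_prop)).aestronglyMeasurable
    (Eventually.of_forall fun x s hs => by
      by_cases hx : x ∈ k
      · simpa [hx] using hC (s, x) ⟨hs, hx⟩
      · simp [hx, h0 s x hx])
    ((integrable_indicator_iff hk.measurableSet).2 (integrableOn_const hk.measure_lt_top.ne))
    (Eventually.of_forall fun x s _ => slice_hasDerivAt hG s x)
  exact this.2

lemma ibp_compact {g h : EuclideanSpace ℝ (Fin n) → ℝ} (hg : ContDiff ℝ (⊤ : ℕ∞) g)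
    (hh : ContDiff ℝ (⊤ : ℕ∞) h) (hgc : HasCompactSupport g) (e : EuclideanSpace ℝ (Fin n)) :
    Integrable (fun x => g x * fderiv ℝ h x e) ∧ Integrable (fun x => fderiv ℝ g x e * h x) ∧
    ∫ x, g x * fderiv ℝ h x e = - ∫ x, fderiv ℝ g x e * h x := by
  have c1 : Continuous fun x => fderiv ℝ h x e := (dirD_contDiff e hh).continuous
  have c2 : Continuous fun x => fderiv ℝ g x e := (dirD_contDiff e hg).continuous
  have s2 : HasCompactSupport fun x => fderiv ℝ g x e := hgc.fderiv_apply ℝ e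
  have i1 : Integrable (fun x => g x * fderiv ℝ h x e) :=
    (hg.continuous.mul c1).integrable_of_hasCompactSupport hgc.mul_right
  have i2 : Integrable (fun x => fderiv ℝ g x e * h x) :=
    (c2.mul hh.continuous).integrable_of_hasCompactSupport s2.mul_right
  refine ⟨i1, i2, ?_⟩
  exact integral_mul_fderiv_eq_neg_fderiv_mul_of_integrable i2 i1
    ((hg.continuous.mul hh.continuous).integrable_of_hasCompactSupport hgc.mul_right)
    (fun x _ => hg.differentiable (by simp) x) (fun x _ => hh.differentiable (by simp) x)

lemma slice_contDiff {F : ℝ × EuclideanSpace ℝ (Fin n) → ℝ} (hF : ContDiff ℝ (⊤ : ℕ∞) F) (t : ℝ) :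
    ContDiff ℝ (⊤ : ℕ∞) (fun x => F (t, x)) :=
  hF.comp (contDiff_const.prodMk contDiff_id)

lemma energy_deriv {V : ℝ × EuclideanSpace ℝ (Fin n) → ℝ} (hV : ContDiff ℝ (⊤ : ℕ∞) V)
    {χ : EuclideanSpace ℝ (Fin n) → ℝ} (hχ : ContDiff ℝ (⊤ : ℕ∞) χ) (hχc : HasCompactSupport χ) (t : ℝ) :
    HasDerivAt (fun s => ∫ x, χ x ^ 2 * ‖fderiv ℝ (fun y => V (s, y)) x‖ ^ 2)
      (∫ x, -2 * (deriv (fun s => V (s, x)) t) * (χ x ^ 2 * laplacian (fun y => V (t, y)) x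
        + 2 * χ x * ∑ i, spaceDeriv χ i x * spaceDeriv (fun y => V (t, y)) i x)) t := by
  set ei : Fin n → ℝ × EuclideanSpace ℝ (Fin n) := fun i => ((0 : ℝ), EuclideanSpace.single i (1 : ℝ)) with hei
  set A : Fin n → ℝ × EuclideanSpace ℝ (Fin n) → ℝ := fun i => dirD (ei i) V with hA
  have hAc : ∀ i, ContDiff ℝ (⊤ : ℕ∞) (A i) := fun i => dirD_contDiff _ hV
  set W := dirD ((1 : ℝ), (0 : EuclideanSpace ℝ (Fin n))) V with hW
  have hWc : ContDiff ℝ (⊤ : ℕ∞) W := dirD_contDiff _ hV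
  set G : ℝ × EuclideanSpace ℝ (Fin n) → ℝ := fun p => χ p.2 ^ 2 * ∑ i, A i p ^ 2 with hG
  have hGc : ContDiff ℝ (⊤ : ℕ∞) G :=
    ((hχ.comp contDiff_snd).pow 2).mul (ContDiff.sum fun i _ => (hAc i).pow 2)
  have hGd := hasDerivAt_param hGc hχc (fun s x hx => by
    simp [hG, image_eq_zero_of_notMem_tsupport hx]) t
  have e1 : (fun s => ∫ x, χ x ^ 2 * ‖fderiv ℝ (fun y => V (s, y)) x‖ ^ 2) = fun s => ∫ x, G (s, x) := by
    funext s
    congr 1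
    funext x
    rw [dual_norm_sq_sum]
    simp only [hG]
    congr 1
    exact Finset.sum_congr rfl fun i _ => by rw [← spaceDeriv, slice_spaceDeriv hV]
  rw [e1]
  convert hGd using 1
  have e2 : ∀ x, dirD ((1 : ℝ), (0 : EuclideanSpace ℝ (Fin n))) G (t, x)
      = ∑ i, (2 * χ x ^ 2 * A i (t, x)) * fderiv ℝ (fun y => W (t, y)) x (EuclideanSpace.single i 1) := by
    intro x
    have h1 : HasDerivAt (fun s => G (s, x)) (χ x ^ 2 * ∑ i, (2 : ℕ) * A i (t, x) ^ (2 - 1) *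
        dirD ((1 : ℝ), (0 : EuclideanSpace ℝ (Fin n))) (A i) (t, x)) t := by
      have h0 : HasDerivAt (fun s => ∑ i, A i (s, x) ^ 2) (∑ i, (2 : ℕ) * A i (t, x) ^ (2 - 1) *
          dirD ((1 : ℝ), (0 : EuclideanSpace ℝ (Fin n))) (A i) (t, x)) t :=
        HasDerivAt.fun_sum fun i _ => (slice_hasDerivAt (hAc i) t x).fun_pow 2
      exact h0.const_mul (χ x ^ 2)
    rw [(slice_hasDerivAt hGc t x).unique h1, Finset.mul_sum]
    refine Finset.sum_congr rfl fun i _ => ?_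
    rw [hA]
    simp only
    rw [dirD_comm _ _ hV, ← spaceDeriv, slice_spaceDeriv hWc]
    simp only [hW, hei]
    push_cast
    ring
  simp_rw [e2]
  have hgC : ∀ i, ContDiff ℝ (⊤ : ℕ∞) (fun x => 2 * χ x ^ 2 * A i (t, x)) := fun i =>
    (contDiff_const.mul (hχ.pow 2)).mul (slice_contDiff (hAc i) t)
  have hgs : ∀ i, HasCompactSupport (fun x => 2 * χ x ^ 2 * A i (t, x)) := fun i =>
    HasCompactSupport.intro hχc fun x hx => by simp [image_eq_zero_of_notMem_tsupport hx]
  have hibp := fun i => ibp_compact (hgC i) (slice_contDiff hWc t) (hgs i) (EuclideanSpace.single i (1 : ℝ))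
  rw [integral_finsetSum _ fun i _ => (hibp i).1]
  simp_rw [fun i => (hibp i).2.2]
  rw [Finset.sum_neg_distrib, ← integral_finsetSum _ fun i _ => (hibp i).2.1, ← integral_neg]
  congr 1
  funext x
  have e3 : ∀ i, fderiv ℝ (fun x => 2 * χ x ^ 2 * A i (t, x)) x (EuclideanSpace.single i (1 : ℝ))
      = 2 * χ x ^ 2 * dirD (ei i) (A i) (t, x) + 4 * χ x * (spaceDeriv χ i x * A i (t, x)) := by
    intro i
    have d1 := (hχ.differentiable (by simp) x).hasFDerivAt
    have d2 := ((slice_contDiff (hAc i) t).differentiable (by simp) x).hasFDerivAt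
    have d3 := ((d1.pow 2).const_mul 2).fun_mul d2
    have := congrArg (fun L => L (EuclideanSpace.single i (1 : ℝ))) d3.fderiv
    rw [this, ← slice_spaceDeriv (hAc i)]
    simp [spaceDeriv]
    ring
  rw [(slice_hasDerivAt hV t x).deriv, slice_laplacian hV]
  simp_rw [e3, slice_spaceDeriv hV]
  rw [← Finset.sum_mul, Finset.sum_add_distrib, ← Finset.mul_sum, ← Finset.mul_sum]
  simp only [hA, hW, hei]
  ring

/-- Pointwise inequality. -/
lemma pointwise_ineq_s13 {ν K ε c L g w d : ℝ} (hν : 0 < ν) (hK : 0 < K) (hε : 0 ≤ ε) (hc0 : 0 ≤ c) (hc1 : c ≤ 1)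
    (hg : 0 ≤ g) (hw : |w - ν * L| ≤ K * g) (hd : |d| ≤ ε * g) :
    -2 * w * (c ^ 2 * L + 2 * c * d) ≤ -(1 - 2 * ε) * ν * (c ^ 2 * L ^ 2)
      + (K ^ 2 / ν + ε * (2 * ν + 4 * K)) * g ^ 2 := by
  obtain ⟨b, rfl⟩ : ∃ b, w = ν * L + b := ⟨w - ν * L, by ring⟩
  have hb : |b| ≤ K * g := by simpa using hw
  have h1 : -2 * b * (c ^ 2 * L) ≤ ν * (c ^ 2 * L ^ 2) + K ^ 2 / ν * g ^ 2 := by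
    have hb2 : b ^ 2 ≤ (K * g) ^ 2 := sq_le_sq' (by linarith [neg_abs_le b]) (by linarith [le_abs_self b])
    have : -2 * b * L ≤ ν * L ^ 2 + b ^ 2 / ν := by
      have : ν * L ^ 2 + b ^ 2 / ν - (-2 * b * L) = (ν * L + b) ^ 2 / ν := by field_simp; ring
      have : 0 ≤ (ν * L + b) ^ 2 / ν := by positivity
      linarith
    have h3 : b ^ 2 / ν ≤ K ^ 2 / ν * g ^ 2 := by
      rw [div_mul_eq_mul_div, ← mul_pow]; gcongr
    have h4 : c ^ 2 * (-2 * b * L) ≤ c ^ 2 * (ν * L ^ 2 + K ^ 2 / ν * g ^ 2) := by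
      gcongr; linarith
    have h5 : c ^ 2 * (K ^ 2 / ν * g ^ 2) ≤ 1 * (K ^ 2 / ν * g ^ 2) := by
      gcongr; nlinarith
    nlinarith
  have h2 : -4 * ν * (c * L) * d ≤ ε * (2 * ν) * ((c * L) ^ 2 + g ^ 2) := by
    have : -((c * L) * d) ≤ |c * L| * (ε * g) := by
      calc _ ≤ |(c * L) * d| := neg_le_abs _
        _ = |c * L| * |d| := abs_mul _ _
        _ ≤ _ := by gcongr
    have h6 : 2 * (|c * L| * g) ≤ (c * L) ^ 2 + g ^ 2 := by
      nlinarith [sq_nonneg (|c * L| - g), sq_abs (c * L)]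
    have h7 : 2 * ν * ε * (2 * (|c * L| * g)) ≤ 2 * ν * ε * ((c * L) ^ 2 + g ^ 2) := by gcongr
    nlinarith
  have h3 : -4 * (c * b * d) ≤ ε * (4 * K) * g ^ 2 := by
    have : -(c * b * d) ≤ 1 * (K * g) * (ε * g) := by
      calc _ ≤ |c * b * d| := neg_le_abs _
        _ = |c| * |b| * |d| := by rw [abs_mul, abs_mul]
        _ ≤ _ := by rw [abs_of_nonneg hc0]; gcongr
    nlinarith
  nlinarith

lemma laplacian_continuous {V : ℝ × EuclideanSpace ℝ (Fin n) → ℝ} (hV : ContDiff ℝ (⊤ : ℕ∞) V) :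
    Continuous (fun p : ℝ × EuclideanSpace ℝ (Fin n) => laplacian (fun y => V (p.1, y)) p.2) := by
  have : (fun p : ℝ × EuclideanSpace ℝ (Fin n) => laplacian (fun y => V (p.1, y)) p.2)
      = fun p => ∑ i, dirD ((0 : ℝ), EuclideanSpace.single i (1 : ℝ))
      (dirD ((0 : ℝ), EuclideanSpace.single i (1 : ℝ)) V) p := by
    funext p
    exact slice_laplacian hV p.1 p.2
  rw [this]
  exact continuous_finsetSum _ fun i _ => (dirD_contDiff _ (dirD_contDiff _ hV)).continuous

lemma energy_ineq {V : ℝ × EuclideanSpace ℝ (Fin n) → ℝ} (hV : ContDiff ℝ (⊤ : ℕ∞) V)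
    {χ : EuclideanSpace ℝ (Fin n) → ℝ} (hχ : ContDiff ℝ (⊤ : ℕ∞) χ) (hχc : HasCompactSupport χ)
    (hχ0 : ∀ x, 0 ≤ χ x) (hχ1 : ∀ x, χ x ≤ 1) {ε ν K : ℝ} (hε : 0 ≤ ε) (hν : 0 < ν) (hK : 0 < K)
    (hχε : ∀ x, ‖fderiv ℝ χ x‖ ≤ ε) (t : ℝ)
    (hpde : ∀ x, |deriv (fun s => V (s, x)) t - ν * laplacian (fun y => V (t, y)) x|
      ≤ K * ‖fderiv ℝ (fun y => V (t, y)) x‖)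
    (hint : Integrable fun x => ‖fderiv ℝ (fun y => V (t, y)) x‖ ^ 2) :
    (∫ x, -2 * (deriv (fun s => V (s, x)) t) * (χ x ^ 2 * laplacian (fun y => V (t, y)) x
        + 2 * χ x * ∑ i, spaceDeriv χ i x * spaceDeriv (fun y => V (t, y)) i x))
      ≤ -(1 - 2 * ε) * ν * (∫ x, χ x ^ 2 * laplacian (fun y => V (t, y)) x ^ 2)
        + (K ^ 2 / ν + ε * (2 * ν + 4 * K)) * ∫ x, ‖fderiv ℝ (fun y => V (t, y)) x‖ ^ 2 := by
  have cL : Continuous (fun x => laplacian (fun y => V (t, y)) x) :=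
    (laplacian_continuous hV).comp (by fun_prop : Continuous fun x : EuclideanSpace ℝ (Fin n) => (t, x))
  have i1 : Integrable (fun x => χ x ^ 2 * laplacian (fun y => V (t, y)) x ^ 2) := by
    refine ((hχ.continuous.pow 2).mul (cL.pow 2)).integrable_of_hasCompactSupport
      (HasCompactSupport.intro hχc fun x hx => by simp [image_eq_zero_of_notMem_tsupport hx])
  have cW : Continuous fun x => deriv (fun s => V (s, x)) t := by
    simp_rw [fun x => (slice_hasDerivAt hV t x).deriv]
    exact (slice_contDiff (dirD_contDiff _ hV) t).continuous
  have cd : ∀ {g : EuclideanSpace ℝ (Fin n) → ℝ}, ContDiff ℝ (⊤ : ℕ∞) g → ∀ i, Continuous (spaceDeriv g i) :=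
    fun hg i => (dirD_contDiff (EuclideanSpace.single i (1 : ℝ)) hg).continuous
  have i0 : Integrable (fun x => -2 * (deriv (fun s => V (s, x)) t) *
      (χ x ^ 2 * laplacian (fun y => V (t, y)) x
        + 2 * χ x * ∑ i, spaceDeriv χ i x * spaceDeriv (fun y => V (t, y)) i x)) := by
    refine Continuous.integrable_of_hasCompactSupport ?_
      (HasCompactSupport.intro hχc fun x hx => by simp [image_eq_zero_of_notMem_tsupport hx])
    refine (continuous_const.mul cW).mul (((hχ.continuous.pow 2).mul cL).add
      ((continuous_const.mul hχ.continuous).mul (continuous_finsetSum _ fun i _ => ?_)))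
    exact (cd hχ i).mul (cd (slice_contDiff hV t) i)
  rw [← integral_const_mul, ← integral_const_mul, ← integral_add (i1.const_mul _) (hint.const_mul _)]
  refine integral_mono i0 ((i1.const_mul _).add (hint.const_mul _)) fun x => ?_
  refine pointwise_ineq_s13 hν hK hε (hχ0 x) (hχ1 x) (norm_nonneg _) (hpde x) ?_
  refine le_trans ?_ (mul_le_mul_of_nonneg_right (hχε x) (norm_nonneg _))
  apply abs_le_of_sq_le_sq _ (by positivity)
  rw [mul_pow, dual_norm_sq_sum, dual_norm_sq_sum]
  exact Finset.sum_mul_sq_le_sq_mul_sq _ _ _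

lemma exists_cutoff (n : ℕ) : ∃ χ : ℕ → EuclideanSpace ℝ (Fin n) → ℝ, ∃ ε : ℕ → ℝ,
    (∀ k, ContDiff ℝ (⊤ : ℕ∞) (χ k)) ∧ (∀ k, HasCompactSupport (χ k)) ∧ (∀ k x, 0 ≤ χ k x) ∧
    (∀ k x, χ k x ≤ 1) ∧ (∀ k, 0 ≤ ε k) ∧ Tendsto ε atTop (𝓝 0) ∧ (∀ k x, ‖fderiv ℝ (χ k) x‖ ≤ ε k) ∧
    (∀ (k : ℕ) x, ‖x‖ ≤ k → χ k x = 1) := by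
  let φ : ContDiffBump (0 : EuclideanSpace ℝ (Fin n)) := ⟨1, 2, by norm_num, by norm_num⟩
  have hφ : ContDiff ℝ (⊤ : ℕ∞) φ := φ.contDiff
  obtain ⟨C, hC⟩ := (hφ.continuous_fderiv (by simp)).bounded_above_of_compact_support
    (φ.hasCompactSupport.fderiv ℝ)
  have hC0 : 0 ≤ C := (norm_nonneg _).trans (hC 0)
  have hpos : ∀ k : ℕ, (0 : ℝ) < (k : ℝ) + 1 := fun k => by positivity
  refine ⟨fun k x => φ (((k : ℝ) + 1)⁻¹ • x), fun k => C * ((k : ℝ) + 1)⁻¹, ?_, ?_, ?_, ?_, ?_, ?_, ?_, ?_⟩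
  · intro k
    exact hφ.comp (contDiff_const_smul _)
  · intro k
    exact φ.hasCompactSupport.comp_smul (inv_ne_zero (hpos k).ne')
  · intro k x; exact φ.nonneg
  · intro k x; exact φ.le_one
  · intro k; exact mul_nonneg hC0 (inv_nonneg.2 (hpos k).le)
  · have := (tendsto_one_div_add_atTop_nhds_zero_nat (𝕜 := ℝ)).const_mul C
    simpa using this
  · intro k x
    have h1 : HasFDerivAt (fun y : EuclideanSpace ℝ (Fin n) => ((k : ℝ) + 1)⁻¹ • y)
        (((k : ℝ) + 1)⁻¹ • ContinuousLinearMap.id ℝ _) x := (hasFDerivAt_id x).fun_const_smul _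
    have h2 := ((hφ.differentiable (by simp)) (((k : ℝ) + 1)⁻¹ • x)).hasFDerivAt.comp x h1
    have h3 : fderiv ℝ (fun x => φ (((k : ℝ) + 1)⁻¹ • x)) x = _ := h2.fderiv
    rw [h3, ContinuousLinearMap.comp_smul, ContinuousLinearMap.comp_id, norm_smul, mul_comm,
      Real.norm_of_nonneg (inv_nonneg.2 (hpos k).le)]
    exact mul_le_mul_of_nonneg_right (hC _) (inv_nonneg.2 (hpos k).le)
  · intro k x hx
    apply φ.one_of_mem_closedBall
    rw [mem_closedBall_zero_iff, norm_smul, Real.norm_of_nonneg (inv_nonneg.2 (hpos k).le)]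
    change _ ≤ (1 : ℝ)
    rw [inv_mul_le_iff₀ (hpos k)]
    linarith

lemma exists_time_cutoff {u : ℝ → EuclideanSpace ℝ (Fin n) → ℝ}
    (hu : ContDiffOn ℝ (⊤ : ℕ∞) (Function.uncurry u) (Set.Ici 0 ×ˢ Set.univ)) {t : ℝ} (ht : 0 < t) :
    ∃ V : ℝ × EuclideanSpace ℝ (Fin n) → ℝ, ContDiff ℝ (⊤ : ℕ∞) V ∧
      ∀ s ∈ Metric.ball t (t / 4), ∀ x, V (s, x) = u s x := by
  let φ : ContDiffBump t := ⟨t / 4, t / 2, by linarith, by linarith⟩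
  refine ⟨fun p => φ p.1 * Function.uncurry u p, ?_, ?_⟩
  · rw [contDiff_iff_contDiffAt]
    intro p
    by_cases hp : 0 < p.1
    · have h1 : ContDiffAt ℝ (⊤ : ℕ∞) (fun p : ℝ × EuclideanSpace ℝ (Fin n) => φ p.1) p :=
        (φ.contDiff.comp contDiff_fst).contDiffAt
      exact h1.mul (hu.contDiffAt (prod_mem_nhds (Ici_mem_nhds hp) univ_mem))
    · have : (fun p => φ p.1 * Function.uncurry u p) =ᶠ[𝓝 p] fun _ => 0 := by
        have : ∀ᶠ q : ℝ × EuclideanSpace ℝ (Fin n) in 𝓝 p, q.1 < t / 4 :=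
          (continuous_fst.tendsto p).eventually (gt_mem_nhds (by linarith))
        filter_upwards [this] with q hq
        rw [φ.zero_of_le_dist, zero_mul]
        change t / 2 ≤ _
        rw [Real.dist_eq, abs_sub_comm]
        exact le_trans (by linarith) (le_abs_self _)
      exact contDiffAt_const.congr_of_eventuallyEq this
  · intro s hs x
    simp only
    rw [φ.one_of_mem_closedBall (Metric.ball_subset_closedBall hs), one_mul]
    rfl

lemma flux_deriv_bound {f : ℝ → EuclideanSpace ℝ (Fin n)} {K : ℝ} (hK : 0 < K)
    (hfdiff : Differentiable ℝ f)
    (hflip : LipschitzOnWith K.toNNReal f (Set.Icc (-1) 1)) {z : ℝ} (hz : |z| ≤ 1) : ‖deriv f z‖ ≤ K := by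
  have hz' : z ∈ Icc (-1 : ℝ) 1 := abs_le.1 hz
  have h1 := (hfdiff z).hasDerivAt.hasDerivWithinAt (s := Icc (-1 : ℝ) 1)
  rw [hasDerivWithinAt_iff_tendsto_slope] at h1
  have : (𝓝[Icc (-1 : ℝ) 1 \ {z}] z).NeBot := by
    have hu : UniqueDiffWithinAt ℝ (Icc (-1 : ℝ) 1) z := uniqueDiffOn_Icc (by norm_num) z hz'
    exact accPt_principal_iff_nhdsWithin.1 (uniqueDiffWithinAt_iff_accPt.1 hu) 
  refine le_of_tendsto h1.norm ?_
  filter_upwards [self_mem_nhdsWithin] with y hy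
  have := hflip.dist_le_mul y hy.1 z hz'
  rw [dist_eq_norm, dist_eq_norm, Real.coe_toNNReal _ hK.le] at this
  have hne : y - z ≠ 0 := sub_ne_zero.2 hy.2
  rw [slope_def_module, norm_smul, norm_inv, inv_mul_le_iff₀ (norm_pos_iff.2 hne)]
  linarith

lemma divFlux_bound {f : ℝ → EuclideanSpace ℝ (Fin n)} {K : ℝ} (hK : 0 < K)
    (hfdiff : Differentiable ℝ f)
    (hflip : LipschitzOnWith K.toNNReal f (Set.Icc (-1) 1)) {v : EuclideanSpace ℝ (Fin n) → ℝ}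
    (hv : Differentiable ℝ v) (hb : ∀ x, |v x| ≤ 1) (x : EuclideanSpace ℝ (Fin n)) :
    |divFlux f v x| ≤ K * ‖fderiv ℝ v x‖ := by
  have h1 : divFlux f v x = ∑ i, (deriv f (v x)) i * fderiv ℝ v x (EuclideanSpace.single i 1) := by
    unfold divFlux
    refine Finset.sum_congr rfl fun i _ => ?_
    have h2 : HasDerivAt (fun z => f z i) (deriv f (v x) i) (v x) :=
      (EuclideanSpace.proj (𝕜 := ℝ) i).hasFDerivAt.comp_hasDerivAt (v x) (hfdiff (v x)).hasDerivAt
    have h3 : HasFDerivAt (fun y => f (v y) i) _ x := h2.comp_hasFDerivAt x (hv x).hasFDerivAt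
    unfold spaceDeriv
    rw [h3.fderiv]
    simp
  rw [h1]
  refine le_trans ?_ (mul_le_mul_of_nonneg_right (flux_deriv_bound hK hfdiff hflip (hb x)) (norm_nonneg _))
  apply abs_le_of_sq_le_sq _ (by positivity)
  rw [mul_pow, dual_norm_sq_sum, EuclideanSpace.norm_sq_eq]
  simp_rw [Real.norm_eq_abs, sq_abs]
  exact Finset.sum_mul_sq_le_sq_mul_sq _ _ _

lemma main_aux {ν K : ℝ} (hν : 0 < ν) (hK : 0 < K) {V : ℝ × EuclideanSpace ℝ (Fin n) → ℝ}
    (hV : ContDiff ℝ (⊤ : ℕ∞) V) {t r : ℝ} (hr : 0 < r)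
    (hpde : ∀ s ∈ Metric.ball t r, ∀ x, |deriv (fun s => V (s, x)) s - ν * laplacian (fun y => V (s, y)) x|
      ≤ K * ‖fderiv ℝ (fun y => V (s, y)) x‖)
    (hint : ∀ s ∈ Metric.ball t r, Integrable fun x => ‖fderiv ℝ (fun y => V (s, y)) x‖ ^ 2)
    (hlap : Integrable fun x => laplacian (fun y => V (t, y)) x ^ 2)
    {E' : ℝ} (hE : HasDerivAt (fun s => ∫ x, ‖fderiv ℝ (fun y => V (s, y)) x‖ ^ 2) E' t) :
    E' ≤ K ^ 2 / ν * (∫ x, ‖fderiv ℝ (fun y => V (t, y)) x‖ ^ 2)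
      - ν * ∫ x, laplacian (fun y => V (t, y)) x ^ 2 := by
  obtain ⟨χ, ε, hχ, hχc, hχ0, hχ1, hε0, hε, hχε, hχk⟩ := exists_cutoff n
  set E : ℝ → ℝ := fun s => ∫ x, ‖fderiv ℝ (fun y => V (s, y)) x‖ ^ 2 with hEdef
  set D := ∫ x, laplacian (fun y => V (t, y)) x ^ 2 with hD
  suffices h : ∀ η > 0, E' ≤ K ^ 2 / ν * (E t + η) - ν * (D - η) by
    have hlim : Tendsto (fun η : ℝ => K ^ 2 / ν * (E t + η) - ν * (D - η)) (𝓝[>] 0)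
        (𝓝 (K ^ 2 / ν * (E t + 0) - ν * (D - 0))) := by
      refine Tendsto.mono_left (Continuous.tendsto ?_ 0) nhdsWithin_le_nhds
      fun_prop
    rw [add_zero, sub_zero] at hlim
    exact ge_of_tendsto hlim (by filter_upwards [self_mem_nhdsWithin] with η hη using h η hη)
  intro η hη
  -- a ball carrying most of D
  have hballs : Tendsto (fun k : ℕ => ∫ x in Metric.closedBall (0 : EuclideanSpace ℝ (Fin n)) k,
      laplacian (fun y => V (t, y)) x ^ 2) atTop (𝓝 D) := by
    have := tendsto_setIntegral_of_monotone (μ := volume)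
      (s := fun k : ℕ => Metric.closedBall (0 : EuclideanSpace ℝ (Fin n)) k)
      (f := fun x => laplacian (fun y => V (t, y)) x ^ 2)
      (fun k => Metric.isClosed_closedBall.measurableSet)
      (fun a b hab => Metric.closedBall_subset_closedBall (by exact_mod_cast hab)) hlap.integrableOn
    rwa [Metric.iUnion_closedBall_nat, setIntegral_univ] at this
  obtain ⟨k0, hk0⟩ := (hballs.eventually (lt_mem_nhds (show D - η < D by linarith))).exists
  have hcont : Continuous (fun s => ∫ x in Metric.closedBall (0 : EuclideanSpace ℝ (Fin n)) k0,
      laplacian (fun y => V (s, y)) x ^ 2) :=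
    continuous_parametric_integral_of_continuous
      (f := fun s x => laplacian (fun y => V (s, y)) x ^ 2)
      (by
        have h := laplacian_continuous hV
        have h2 : Continuous fun p : ℝ × EuclideanSpace ℝ (Fin n) =>
          laplacian (fun y => V (p.1, y)) p.2 ^ 2 := by fun_prop
        exact h2) (isCompact_closedBall _ _)
  have ev1 := hcont.continuousAt.eventually (lt_mem_nhds hk0)
  have ev2 := hE.continuousAt.eventually (gt_mem_nhds (show E t < E t + η by linarith))
  obtain ⟨δ, hδ, hball⟩ := Metric.eventually_nhds_iff_ball.1
    ((ev1.and ev2).and (Metric.ball_mem_nhds t hr))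
  have hDge : ∀ s ∈ Metric.ball t δ, ∀ k ≥ k0, D - η ≤
      ∫ x, χ k x ^ 2 * laplacian (fun y => V (s, y)) x ^ 2 := by
    intro s hs k hk
    refine (hball s hs).1.1.le.trans ?_
    have cL : Continuous (fun x => laplacian (fun y => V (s, y)) x) :=
      (laplacian_continuous hV).comp (by fun_prop : Continuous fun x : EuclideanSpace ℝ (Fin n) => (s, x))
    have i1 : Integrable (fun x => χ k x ^ 2 * laplacian (fun y => V (s, y)) x ^ 2) := by
      refine (((hχ k).continuous.pow 2).mul (cL.pow 2)).integrable_of_hasCompactSupport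
        (HasCompactSupport.intro (hχc k) fun x hx => by simp [image_eq_zero_of_notMem_tsupport hx])
    refine le_trans (le_of_eq ?_) (setIntegral_le_integral (s := Metric.closedBall 0 k0) i1
      (Eventually.of_forall fun x => by positivity))
    refine setIntegral_congr_fun Metric.isClosed_closedBall.measurableSet fun x hx => ?_
    have : ‖x‖ ≤ k := (mem_closedBall_zero_iff.1 hx).trans (by exact_mod_cast hk)
    simp [hχk k x this]
  set c : ℕ → ℝ := fun k => -(1 - 2 * ε k) * ν * (D - η)
    + (K ^ 2 / ν + ε k * (2 * ν + 4 * K)) * (E t + η) with hc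
  have hclim : Tendsto c atTop (𝓝 (K ^ 2 / ν * (E t + η) - ν * (D - η))) := by
    have : Tendsto c atTop (𝓝 (-(1 - 2 * 0) * ν * (D - η)
      + (K ^ 2 / ν + 0 * (2 * ν + 4 * K)) * (E t + η))) :=
      ((((hε.const_mul 2).const_sub 1).neg.mul_const ν).mul_const _).add
        (((hε.mul_const _).const_add _).mul_const _)
    convert this using 2
    ring
  have hElim : ∀ s ∈ Metric.ball t δ, Tendsto
      (fun k => ∫ x, χ k x ^ 2 * ‖fderiv ℝ (fun y => V (s, y)) x‖ ^ 2) atTop (𝓝 (E s)) := by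
    intro s hs
    refine tendsto_integral_of_dominated_convergence
      (fun x => ‖fderiv ℝ (fun y => V (s, y)) x‖ ^ 2) ?_ (hint s (hball s hs).2) ?_ ?_
    · intro k
      exact ((hχ k).continuous.pow 2).aestronglyMeasurable.mul (hint s (hball s hs).2).1
    · intro k
      refine Eventually.of_forall fun x => ?_
      rw [Real.norm_of_nonneg (by positivity)]
      refine mul_le_of_le_one_left (by positivity) ?_
      exact pow_le_one₀ (hχ0 k x) (hχ1 k x)
    · refine Eventually.of_forall fun x => ?_
      refine tendsto_const_nhds.congr' ?_
      obtain ⟨m, hm⟩ := exists_nat_ge ‖x‖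
      filter_upwards [eventually_ge_atTop m] with k hk
      rw [hχk k x (hm.trans (by exact_mod_cast hk))]
      simp
  have hstep : ∀ s ∈ Ioo t (t + δ), E s - E t ≤ (K ^ 2 / ν * (E t + η) - ν * (D - η)) * (s - t) := by
    intro s hs
    have hsub : ∀ τ ∈ Icc t s, τ ∈ Metric.ball t δ := by
      intro τ hτ
      rw [Metric.mem_ball, Real.dist_eq, abs_lt]
      constructor <;> linarith [hτ.1, hτ.2, hs.1, hs.2]
    have htS : t ∈ Icc t s := ⟨le_rfl, hs.1.le⟩
    have hsS : s ∈ Icc t s := ⟨hs.1.le, le_rfl⟩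
    refine le_of_tendsto_of_tendsto ((hElim s (hsub s hsS)).sub (hElim t (hsub t htS)))
      (hclim.mul_const (s - t)) ?_
    filter_upwards [eventually_ge_atTop k0, hε.eventually (gt_mem_nhds (show (0 : ℝ) < 1 / 2 by norm_num))]
      with k hk hεk
    have hder := fun τ => energy_deriv hV (hχ k) (hχc k) τ
    refine (convex_Icc t s).image_sub_le_mul_sub_of_deriv_le
      (fun τ _ => (hder τ).continuousAt.continuousWithinAt)
      (fun τ _ => (hder τ).differentiableAt.differentiableWithinAt) ?_ t htS s hsS hs.1.le
    intro τ hτ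
    have hτb := hsub τ (interior_subset hτ)
    rw [(hder τ).deriv]
    refine (energy_ineq hV (hχ k) (hχc k) (hχ0 k) (hχ1 k) (hε0 k) hν hK (hχε k) τ
      (hpde τ (hball τ hτb).2) (hint τ (hball τ hτb).2)).trans ?_
    have a1 := hDge τ hτb k hk
    have a2 := (hball τ hτb).1.2.le
    have a3 : 0 ≤ (1 - 2 * ε k) * ν := mul_nonneg (by linarith) hν.le
    have a4 : 0 ≤ K ^ 2 / ν + ε k * (2 * ν + 4 * K) := by
      have := hε0 k
      positivity
    have b1 := mul_le_mul_of_nonneg_left a1 a3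
    have b2 := mul_le_mul_of_nonneg_left a2 a4
    simp only [hc]
    linarith
  have hslope := hasDerivAt_iff_tendsto_slope.1 hE
  have hslope' : Tendsto (slope E t) (𝓝[>] t) (𝓝 E') :=
    hslope.mono_left (nhdsWithin_mono _ fun x hx => ne_of_gt hx)
  refine le_of_tendsto hslope' ?_
  filter_upwards [Ioo_mem_nhdsGT (show t < t + δ by linarith)] with s hs
  rw [slope_def_field, div_le_iff₀ (by linarith [hs.1])]
  exact hstep s hs

end Helpers

/-- **Proposition (differential inequality for the enstrophy):**
`(d/dt) (1/2) ∫ |∇u(t)|² ≤ (K²/(2ν)) ∫ |∇u(t)|² − (ν/2) ∫ |Δu(t)|²` for `t > 0`. -/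
theorem enstrophy_differential_inequality
    (n : ℕ) (hn : 1 ≤ n) (K : ℝ) (hK : 0 < K) (ν : ℝ) (hν : 0 < ν)
    (f : ℝ → EuclideanSpace ℝ (Fin n))
    (hfdiff : Differentiable ℝ f)
    (hflip : LipschitzOnWith K.toNNReal f (Set.Icc (-1) 1))
    (u : ℝ → EuclideanSpace ℝ (Fin n) → ℝ)
    (husmooth : ContDiffOn ℝ (⊤ : ℕ∞) (Function.uncurry u) (Set.Ici 0 ×ˢ Set.univ))
    (hupde : ∀ t x, 0 < t →
      deriv (fun s => u s x) t + divFlux f (u t) x = ν * laplacian (u t) x)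
    (hubound : ∀ t, 0 ≤ t → ∀ x, |u t x| ≤ 1)
    (hgradL2 : ∀ t, 0 ≤ t → Integrable (fun x => ‖fderiv ℝ (u t) x‖ ^ 2))
    (hlapL2 : ∀ t, 0 ≤ t → Integrable (fun x => (laplacian (u t) x) ^ 2))
    (hEdiff : DifferentiableOn ℝ
      (fun t => ∫ x, ‖fderiv ℝ (u t) x‖ ^ 2) (Set.Ici 0)) :
    ∀ t, 0 < t →
      deriv (fun s => (1 / 2) * ∫ x, ‖fderiv ℝ (u s) x‖ ^ 2) t
        ≤ K ^ 2 / (2 * ν) * (∫ x, ‖fderiv ℝ (u t) x‖ ^ 2)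
          - ν / 2 * ∫ x, (laplacian (u t) x) ^ 2 := by
  intro t ht
  obtain ⟨V, hV, hVu⟩ := exists_time_cutoff husmooth ht
  have hr : 0 < t / 4 := by linarith
  have htb : t ∈ Metric.ball t (t / 4) := Metric.mem_ball_self hr
  have hfun : ∀ s ∈ Metric.ball t (t / 4), (fun y => V (s, y)) = u s :=
    fun s hs => funext fun x => hVu s hs x
  have hpos : ∀ s ∈ Metric.ball t (t / 4), 0 < s := by
    intro s hs
    rw [Metric.mem_ball, Real.dist_eq, abs_lt] at hs
    linarith [hs.1]
  have hE0 : HasDerivAt (fun s => ∫ x, ‖fderiv ℝ (u s) x‖ ^ 2)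
      (deriv (fun s => ∫ x, ‖fderiv ℝ (u s) x‖ ^ 2) t) t :=
    (hEdiff.differentiableAt (Ici_mem_nhds ht)).hasDerivAt
  have hE1 : HasDerivAt (fun s => ∫ x, ‖fderiv ℝ (fun y => V (s, y)) x‖ ^ 2)
      (deriv (fun s => ∫ x, ‖fderiv ℝ (u s) x‖ ^ 2) t) t := by
    refine hE0.congr_of_eventuallyEq ?_
    filter_upwards [Metric.ball_mem_nhds t hr] with s hs
    rw [hfun s hs]
  have key := main_aux hν hK hV hr (t := t) ?_ ?_ ?_ hE1
  · rw [hfun t htb] at key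
    rw [(hE0.const_mul (1 / 2)).deriv]
    have h2 : K ^ 2 / (2 * ν) = 1 / 2 * (K ^ 2 / ν) := by field_simp
    rw [h2]
    linarith
  · intro s hs x
    have hd : deriv (fun r => V (r, x)) s = deriv (fun r => u r x) s := by
      apply Filter.EventuallyEq.deriv_eq
      filter_upwards [Metric.isOpen_ball.mem_nhds hs] with r hr'
      exact hVu r hr' x
    have hv : Differentiable ℝ (u s) := by
      rw [← hfun s hs]
      exact (slice_contDiff hV s).differentiable (by simp)
    rw [hd, hfun s hs]
    have h1 := hupde s x (hpos s hs)
    have h2 := divFlux_bound hK hfdiff hflip hv (hubound s (hpos s hs).le) x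
    rw [show deriv (fun r => u r x) s - ν * laplacian (u s) x = -divFlux f (u s) x by linarith, abs_neg]
    exact h2
  · intro s hs
    rw [hfun s hs]
    exact hgradL2 s (hpos s hs).le
  · rw [hfun t htb]
    exact hlapL2 t ht.le
end
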